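/- arXiv:2007.10832 — 3 statements merged into one kernel-verified Lean document; each statement's English description precedes it below -/
import Mathlib

section
/- Let H be an ordered graph on h vertices with interval chromatic number χ<(H)=2. Then there exists a complete multipartite unordered graph B that is a bottlegraph assigned to H and satisfies χ_cr(B) = 1/α*(H), where α*(H) = min{α⁺₁(H)/h, (h − α⁻₁(H) + 1)/h}. -/
open Finset

section Defs

variable {h n : ℕ}

/-- `φ` is an order-preserving embedding of the ordered graph `H` into the ordered graph `G`:
a strictly increasing map carrying edges of `H` to edges of `G`. -/
def IsOrderedCopy (H : SimpleGraph (Fin h)) (G : SimpleGraph (Fin n))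
    (φ : Fin h → Fin n) : Prop :=
  StrictMono φ ∧ ∀ i j : Fin h, H.Adj i j → G.Adj (φ i) (φ j)

/-- `S` is the vertex set of a copy of the ordered graph `H` in the ordered graph `G`. -/
def IsCopySet (H : SimpleGraph (Fin h)) (G : SimpleGraph (Fin n))
    (S : Finset (Fin n)) : Prop :=
  ∃ φ : Fin h → Fin n, IsOrderedCopy H G φ ∧ Finset.image φ Finset.univ = S

/-- `G` has an `H`-tiling (vertex-disjoint copies of `H`) whose copies exactly cover the
vertex set `S`; equivalently, the induced ordered subgraph `G[S]` has a perfect `H`-tiling. -/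
def HasPerfectTilingOn (H : SimpleGraph (Fin h)) (G : SimpleGraph (Fin n))
    (S : Finset (Fin n)) : Prop :=
  ∃ 𝒯 : Finset (Finset (Fin n)),
    (∀ T ∈ 𝒯, IsCopySet H G T) ∧
    (𝒯 : Set (Finset (Fin n))).PairwiseDisjoint id ∧
    𝒯.biUnion id = S

/-- `G` has a perfect `H`-tiling. -/
def HasPerfectTiling (H : SimpleGraph (Fin h)) (G : SimpleGraph (Fin n)) : Prop :=
  HasPerfectTilingOn H G Finset.univ

/-- The degree of a vertex in an ordered graph. -/
noncomputable def odeg (G : SimpleGraph (Fin n)) (v : Fin n) : ℕ :=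
  (G.neighborSet v).ncard

/-- `[h]` can be partitioned into `k` intervals, each independent in `H`
(expressed via a monotone colouring with independent fibres). -/
def HasIntervalColoring (H : SimpleGraph (Fin h)) (k : ℕ) : Prop :=
  ∃ c : Fin h → Fin k, Monotone c ∧ ∀ i j : Fin h, H.Adj i j → c i ≠ c j

/-- The interval chromatic number `χ<(H)` of an ordered graph. -/
noncomputable def intervalChi (H : SimpleGraph (Fin h)) : ℕ :=
  sInf {k | HasIntervalColoring H k}

/-- `α⁺ᵢ(H)`: `α⁺₀ = 0`, and `α⁺_{i+1}` is the largest `k ≤ h` such that the interval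
`[α⁺ᵢ + 1, k]` is independent in `H` (vertices are 1-indexed via `v ↦ (v : ℕ) + 1`). -/
noncomputable def alphaPlus (H : SimpleGraph (Fin h)) : ℕ → ℕ
  | 0 => 0
  | (i + 1) => sSup {k | k ≤ h ∧ ∀ a b : Fin h,
      alphaPlus H i + 1 ≤ (a : ℕ) + 1 → (a : ℕ) + 1 ≤ k →
      alphaPlus H i + 1 ≤ (b : ℕ) + 1 → (b : ℕ) + 1 ≤ k → ¬ H.Adj a b}

/-- `α⁻ᵢ(H)`: `α⁻₀ = h + 1`, and `α⁻_{i+1}` is the smallest `k ≥ 1` such that the interval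
`[k, α⁻ᵢ − 1]` is independent in `H`. -/
noncomputable def alphaMinus (H : SimpleGraph (Fin h)) : ℕ → ℕ
  | 0 => h + 1
  | (i + 1) => sInf {k | 1 ≤ k ∧ ∀ a b : Fin h,
      k ≤ (a : ℕ) + 1 → (a : ℕ) + 1 ≤ alphaMinus H i - 1 →
      k ≤ (b : ℕ) + 1 → (b : ℕ) + 1 ≤ alphaMinus H i - 1 → ¬ H.Adj a b}

/-- `α*(H) = min over 1 ≤ ℓ < χ<(H) of min{α⁺_ℓ/(ℓh), (h − α⁻_ℓ + 1)/(ℓh)}`. -/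
noncomputable def alphaStar (H : SimpleGraph (Fin h)) : ℝ :=
  sInf {x : ℝ | ∃ ℓ : ℕ, 1 ≤ ℓ ∧ ℓ < intervalChi H ∧
    (x = (alphaPlus H ℓ : ℝ) / (ℓ * h) ∨
     x = ((h : ℝ) - alphaMinus H ℓ + 1) / (ℓ * h))}

/-- `α*(H)` for ordered graphs with interval chromatic number 2:
`min{α⁺₁(H)/h, (h − α⁻₁(H) + 1)/h}`. -/
noncomputable def alphaStar2 (H : SimpleGraph (Fin h)) : ℝ :=
  min ((alphaPlus H 1 : ℝ) / h) (((h : ℝ) - alphaMinus H 1 + 1) / h)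

/-- Property A: no edges of `H` within `[1, ⌊h/2⌋ + 1]` nor within `[⌈h/2⌉, h]`. -/
def PropertyA (H : SimpleGraph (Fin h)) : Prop :=
  (∀ a b : Fin h, (a : ℕ) + 1 ≤ h / 2 + 1 → (b : ℕ) + 1 ≤ h / 2 + 1 → ¬ H.Adj a b) ∧
  (∀ a b : Fin h, (h + 1) / 2 ≤ (a : ℕ) + 1 → (h + 1) / 2 ≤ (b : ℕ) + 1 → ¬ H.Adj a b)

/-- Property B: for each partition of `[h]` into nonempty intervals `[1, i], [i+1, h]`
there is an edge of `H` between them. -/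
def PropertyB (H : SimpleGraph (Fin h)) : Prop :=
  ∀ i : ℕ, 1 ≤ i → i < h →
    ∃ a b : Fin h, H.Adj a b ∧ (a : ℕ) + 1 ≤ i ∧ i + 1 ≤ (b : ℕ) + 1

/-- `s(H)`: the smallest vertex adjacent to `h`, and `0` if `h` is isolated. -/
noncomputable def sOG (H : SimpleGraph (Fin h)) : ℕ :=
  sInf {k | ∃ a b : Fin h, H.Adj a b ∧ (a : ℕ) + 1 = k ∧ (b : ℕ) + 1 = h}

open Classical in
/-- `l(H)`: the largest vertex adjacent to `1`, and `h + 1` if `1` is isolated. -/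
noncomputable def lOG (H : SimpleGraph (Fin h)) : ℕ :=
  if ∃ a b : Fin h, H.Adj a b ∧ (a : ℕ) + 1 = 1 then
    sSup {k | ∃ a b : Fin h, H.Adj a b ∧ (a : ℕ) + 1 = 1 ∧ (b : ℕ) + 1 = k}
  else h + 1

/-- The vertex `h` has Property C: `s(H) ≥ 1` and there is an edge within `[s(H), h − 1]`. -/
def PropertyCLast (H : SimpleGraph (Fin h)) : Prop :=
  1 ≤ sOG H ∧ ∃ a b : Fin h, H.Adj a b ∧
    sOG H ≤ (a : ℕ) + 1 ∧ (a : ℕ) + 1 ≤ h - 1 ∧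
    sOG H ≤ (b : ℕ) + 1 ∧ (b : ℕ) + 1 ≤ h - 1

/-- The vertex `1` has Property C: `l(H) ≤ h` and there is an edge within `[2, l(H)]`. -/
def PropertyCFirst (H : SimpleGraph (Fin h)) : Prop :=
  lOG H ≤ h ∧ ∃ a b : Fin h, H.Adj a b ∧
    2 ≤ (a : ℕ) + 1 ∧ (a : ℕ) + 1 ≤ lOG H ∧
    2 ≤ (b : ℕ) + 1 ∧ (b : ℕ) + 1 ≤ lOG H

/-- `S` is an `H`-absorbing set for `W`: both `G[S]` and `G[S ∪ W]` have perfect `H`-tilings. -/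
def IsAbsorbingFor (H : SimpleGraph (Fin h)) (G : SimpleGraph (Fin n))
    (S W : Finset (Fin n)) : Prop :=
  HasPerfectTilingOn H G S ∧ HasPerfectTilingOn H G (S ∪ W)

end Defs

section Regularity

/-- The density `d(A,B) = e(A,B)/(|A||B|)` of a pair of vertex sets in a graph. -/
noncomputable def pairDensity {V : Type*} (G : SimpleGraph V) (A B : Finset V) : ℝ :=
  ({e : V × V | e.1 ∈ A ∧ e.2 ∈ B ∧ G.Adj e.1 e.2}.ncard : ℝ) /
    ((A.card : ℝ) * (B.card : ℝ))

/-- The pair `(A, B)` is `ε`-regular in `G`. -/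
def IsRegularPair {V : Type*} (G : SimpleGraph V) (A B : Finset V) (ε : ℝ) : Prop :=
  ∀ X ⊆ A, ∀ Y ⊆ B, ε * A.card ≤ (X.card : ℝ) → ε * B.card ≤ (Y.card : ℝ) →
    |pairDensity G A B - pairDensity G X Y| < ε

end Regularity

section Bottle

/-- The chromatic number of a finite graph. -/
noncomputable def chromNum {m : ℕ} (B : SimpleGraph (Fin m)) : ℕ :=
  sInf {k | ∃ c : Fin m → Fin k, ∀ x y : Fin m, B.Adj x y → c x ≠ c y}

/-- `σ(B)`: the smallest size of a colour class in any proper colouring of `B`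
with `χ(B)` colours. -/
noncomputable def sigmaMinCl {m : ℕ} (B : SimpleGraph (Fin m)) : ℕ :=
  sInf {c | ∃ C : Fin m → Fin (chromNum B),
    (∀ x y : Fin m, B.Adj x y → C x ≠ C y) ∧
    ∃ i : Fin (chromNum B), c = (Finset.univ.filter (fun v => C v = i)).card}

/-- The critical chromatic number `χ_cr(B) = (χ(B) − 1)·|B|/(|B| − σ(B))`. -/
noncomputable def critChrom {m : ℕ} (B : SimpleGraph (Fin m)) : ℝ :=
  ((chromNum B : ℝ) - 1) * m / ((m : ℝ) - sigmaMinCl B)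

/-- `φ` is an interval labeling of the complete multipartite graph with part function `p`
(with respect to some permutation `σ` of the parts). -/
def IsIntervalLabeling {m k : ℕ} (p : Fin m → Fin k) (φ : Equiv.Perm (Fin m)) : Prop :=
  ∃ σ : Equiv.Perm (Fin k), ∀ x y : Fin m, σ (p x) < σ (p y) → φ x < φ y

/-- `G` is (an isomorphic realisation of) the ordered blow-up `(B(t), φ)` of the complete
multipartite graph `B` with part function `p`: there is a block assignment `β` whose fibres
all have size `t`, compatible with the order induced by `φ`, with adjacency between blocks
given by `B`. -/
def IsOrderedBlowup {m k : ℕ} (p : Fin m → Fin k) (φ : Equiv.Perm (Fin m)) (t : ℕ)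
    {N : ℕ} (G : SimpleGraph (Fin N)) : Prop :=
  ∃ β : Fin N → Fin m,
    (∀ x : Fin m, {u : Fin N | β u = x}.ncard = t) ∧
    (∀ u v : Fin N, u ≤ v → φ (β u) ≤ φ (β v)) ∧
    (∀ u v : Fin N, G.Adj u v ↔ p (β u) ≠ p (β v))

/-- The complete multipartite graph with part function `p` is a bottlegraph assigned to `H`:
for every interval labeling `φ` there is a `t ≥ 1` such that the ordered blow-up `(B(t), φ)`
has a perfect `H`-tiling. -/
def IsBottlegraph {h m k : ℕ} (H : SimpleGraph (Fin h)) (p : Fin m → Fin k) : Prop :=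
  ∀ φ : Equiv.Perm (Fin m), IsIntervalLabeling p φ →
    ∃ t : ℕ, 0 < t ∧ ∀ (N : ℕ) (G : SimpleGraph (Fin N)),
      IsOrderedBlowup p φ t G → HasPerfectTiling H G

end Bottle

section Tiling

variable {h N : ℕ}

/-- The position of vertex `u` in the `c`-th of `t` copies, when the first `j` vertices of the
copies are consecutive blocks of `[0, t * j)` and the others are consecutive blocks
starting at `t * j`. -/
def splitPos (h t j c u : ℕ) : ℕ :=
  if u < j then c * j + u else t * j + c * (h - j) + (u - j)

lemma splitPos_lt {t j c u : ℕ} (hj : j ≤ h) (hc : c < t) (hu : u < h) :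
    splitPos h t j c u < t * h := by
  obtain ⟨d, rfl⟩ := Nat.exists_eq_add_of_le hj
  obtain ⟨e, rfl⟩ := Nat.exists_eq_add_of_lt hc
  unfold splitPos
  split_ifs
  · nlinarith [Nat.zero_le (e * j), Nat.zero_le (e * d), Nat.zero_le (c * d)]
  · have : u - j < d := by omega
    rw [Nat.add_sub_cancel_left]
    nlinarith [Nat.zero_le (e * j), Nat.zero_le (e * d)]

lemma splitPos_strictMono {t j c : ℕ} (hc : c < t) : StrictMono (splitPos h t j c) := by
  intro u v huv
  unfold splitPos
  obtain ⟨e, rfl⟩ := Nat.exists_eq_add_of_lt hc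
  split_ifs
  · omega
  · nlinarith [Nat.zero_le (e * j), Nat.zero_le (c * (h - j))]
  · omega
  · omega

lemma exists_splitPos_eq {t j v : ℕ} (hj : j ≤ h) (hv : v < t * h) :
    ∃ c < t, ∃ u < h, splitPos h t j c u = v := by
  obtain ⟨d, rfl⟩ := Nat.exists_eq_add_of_le hj
  by_cases hvj : v < t * j
  · have hj0 : 0 < j := Nat.pos_of_ne_zero (by rintro rfl; simp at hvj)
    refine ⟨v / j, Nat.div_lt_of_lt_mul (by rwa [mul_comm]), v % j, ?_, ?_⟩
    · have := Nat.mod_lt v hj0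
      omega
    · rw [splitPos, if_pos (Nat.mod_lt v hj0), Nat.div_add_mod']
  · have hlt : v - t * j < d * t := by
      rw [mul_add] at hv
      rw [mul_comm d]
      omega
    have hd0 : 0 < d := Nat.pos_of_ne_zero (by rintro rfl; simp at hlt)
    refine ⟨(v - t * j) / d, Nat.div_lt_of_lt_mul hlt, j + (v - t * j) % d, ?_, ?_⟩
    · have := Nat.mod_lt (v - t * j) hd0
      omega
    · rw [splitPos, if_neg (by omega), Nat.add_sub_cancel_left, Nat.add_sub_cancel_left, add_assoc,
        Nat.div_add_mod']
      omega

/-- A perfect tiling exists as soon as every edge of `H` crosses the cut `j` and, in each of the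
`t` copies given by `splitPos`, the two sides of the cut are completely joined. -/
lemma hasPerfectTiling_of_cut (H : SimpleGraph (Fin h)) (G : SimpleGraph (Fin N)) {t j : ℕ}
    (hN : N = t * h) (hj : j ≤ h)
    (hcut : ∀ u v : Fin h, u < v → H.Adj u v → (u : ℕ) < j ∧ j ≤ v)
    (hG : ∀ c < t, ∀ x y : Fin N, (x : ℕ) < (c + 1) * j → t * j + c * (h - j) ≤ y →
      G.Adj x y) :
    HasPerfectTiling H G := by
  classical
  subst hN
  let f : Fin t → Fin h → Fin (t * h) := fun c u =>
    ⟨splitPos h t j c u, splitPos_lt hj c.2 u.2⟩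
  have hsurj : Function.Surjective (fun z : Fin t × Fin h => f z.1 z.2) := by
    intro v
    obtain ⟨c, hc, u, hu, huv⟩ := exists_splitPos_eq hj v.2
    exact ⟨(⟨c, hc⟩, ⟨u, hu⟩), Fin.ext huv⟩
  have hinj : Function.Injective (fun z : Fin t × Fin h => f z.1 z.2) :=
    ((Fintype.bijective_iff_surjective_and_card _).2 ⟨hsurj, by simp⟩).1
  have hedge : ∀ (c : Fin t) (u v : Fin h), u < v → H.Adj u v → G.Adj (f c u) (f c v) := by
    intro c u v huv hadj
    obtain ⟨h1, h2⟩ := hcut u v huv hadj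
    apply hG c c.2
    · simp only [f, splitPos, if_pos h1]
      rw [add_mul]
      omega
    · simp only [f, splitPos, if_neg (not_lt.2 h2)]
      omega
  refine ⟨univ.image fun c => univ.image (f c), ?_, ?_, ?_⟩
  · intro T hT
    obtain ⟨c, -, rfl⟩ := mem_image.1 hT
    refine ⟨f c, ⟨fun u v huv => splitPos_strictMono c.2 huv, fun u v hadj => ?_⟩, rfl⟩
    rcases lt_trichotomy u v with huv | rfl | huv
    · exact hedge c u v huv hadj
    · exact absurd hadj (H.loopless.irrefl u)
    · exact (hedge c v u huv hadj.symm).symm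
  · intro T hT T' hT' hne
    simp only [coe_image, coe_univ, Set.image_univ, Set.mem_range] at hT hT'
    obtain ⟨c, rfl⟩ := hT
    obtain ⟨c', rfl⟩ := hT'
    refine disjoint_left.2 fun v hv hv' => hne ?_
    simp only [id, mem_image, mem_univ, true_and] at hv hv'
    obtain ⟨u, rfl⟩ := hv
    obtain ⟨u', hu'⟩ := hv'
    have := @hinj (c', u') (c, u) hu'
    rw [(Prod.mk.inj this).1]
  · ext v
    obtain ⟨⟨c, u⟩, rfl⟩ := hsurj v
    simp only [mem_biUnion, mem_image, mem_univ, true_and, id, iff_true]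
    exact ⟨_, ⟨c, rfl⟩, mem_image.2 ⟨u, mem_univ _, rfl⟩⟩

end Tiling

section Blowup

variable {m k N t : ℕ}

/-- The number of vertices in the parts belonging to `S`. -/
def partsCard (p : Fin m → Fin k) (S : Finset (Fin k)) : ℕ := #{x | p x ∈ S}

lemma card_blowup (p : Fin m → Fin k) (β : Fin N → Fin m)
    (hβ : ∀ x : Fin m, {u : Fin N | β u = x}.ncard = t) (S : Finset (Fin k)) :
    #{u | p (β u) ∈ S} = t * partsCard p S := by
  rw [card_eq_sum_card_fiberwise (f := β) (t := univ.filter fun x => p x ∈ S)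
    (fun u hu => by simpa using hu), sum_congr rfl (g := fun _ => t)]
  · rw [sum_const, smul_eq_mul, mul_comm, partsCard]
  · intro x hx
    rw [← hβ x, ← Set.ncard_coe_finset]
    congr 1
    ext u
    simp only [mem_filter, mem_univ, true_and] at hx
    simp only [coe_filter, mem_filter, mem_univ, true_and, Set.mem_ofPred_eq]
    exact ⟨fun hu => hu.2, fun hu => ⟨hu ▸ hx, hu⟩⟩

lemma partsCard_union (p : Fin m → Fin k) {S T : Finset (Fin k)} (hST : Disjoint S T) :
    partsCard p (S ∪ T) = partsCard p S + partsCard p T := by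
  unfold partsCard
  rw [← card_union_of_disjoint]
  · congr 1
    ext x
    simp
  · refine disjoint_left.2 fun x hx hx' => ?_
    simp only [mem_filter, mem_univ, true_and] at hx hx'
    exact disjoint_left.1 hST hx hx'

lemma partsCard_mono (p : Fin m → Fin k) {S T : Finset (Fin k)} (hST : S ⊆ T) :
    partsCard p S ≤ partsCard p T :=
  card_le_card fun x hx => by
    simp only [mem_filter, mem_univ, true_and] at hx ⊢
    exact hST hx

lemma partsCard_empty (p : Fin m → Fin k) : partsCard p ∅ = 0 := by simp [partsCard]

lemma partsCard_univ (p : Fin m → Fin k) : partsCard p univ = m := by simp [partsCard]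

/-- Positions of two vertices lying in the same part of an ordered blow-up. -/
lemma position_bounds (p : Fin m → Fin k) (φ : Equiv.Perm (Fin m)) (σ : Equiv.Perm (Fin k))
    (hσ : ∀ x y : Fin m, σ (p x) < σ (p y) → φ x < φ y) (β : Fin N → Fin m)
    (hβ : ∀ x : Fin m, {u : Fin N | β u = x}.ncard = t)
    (hmono : ∀ u v : Fin N, u ≤ v → φ (β u) ≤ φ (β v)) (x y : Fin N)
    (hxy : p (β x) = p (β y)) :
    ∃ e : Fin k, t * partsCard p {i | σ i < σ e} ≤ x ∧
      y < t * (partsCard p {i | σ i < σ e} + partsCard p {e}) := by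
  have hq : ∀ u v : Fin N, u ≤ v → σ (p (β u)) ≤ σ (p (β v)) := fun u v huv =>
    not_lt.1 fun hlt => (hmono u v huv).not_gt (hσ _ _ hlt)
  have hdisj : Disjoint (univ.filter fun i => σ i < σ (p (β x))) {p (β x)} := by simp
  refine ⟨p (β x), ?_, ?_⟩
  · rw [← card_blowup p β hβ, ← Fin.card_Iio x]
    refine card_le_card fun u hu => ?_
    simp only [mem_filter, mem_univ, true_and] at hu
    exact mem_Iio.2 (not_le.1 fun hle => (hq x u hle).not_gt hu)
  · rw [← partsCard_union p hdisj, ← card_blowup p β hβ, ← Nat.succ_le_iff, Nat.succ_eq_add_one,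
      ← Fin.card_Iic y]
    refine card_le_card fun u hu => ?_
    have := hq u y (mem_Iic.1 hu)
    rw [← hxy] at this
    simp only [mem_filter, mem_univ, true_and, mem_union, mem_singleton]
    exact this.lt_or_eq.imp id fun he => σ.injective he

end Blowup

section BottleParts

variable {h s : ℕ}

/-- Parts of `[h]` of size `s`, except that the last one may be smaller (but is nonempty). -/
def bottlePart (h s : ℕ) (x : Fin h) : Fin ((h - 1) / s + 1) :=
  ⟨x / s, Nat.lt_succ_of_le (Nat.div_le_div_right (by omega))⟩

lemma partsCard_bottlePart_singleton (hs : 0 < s) (i : Fin ((h - 1) / s + 1)) :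
    partsCard (bottlePart h s) {i} = min s (h - s * i) := by
  have hcard : partsCard (bottlePart h s) {i} = #(Ico (s * i) (min (s * i + s) h)) := by
    unfold partsCard
    rw [← card_map Fin.valEmbedding]
    congr 1
    ext v
    simp only [mem_map, mem_filter, mem_univ, true_and, mem_singleton, mem_Ico,
      Fin.valEmbedding_apply, bottlePart, Fin.ext_iff, lt_min_iff]
    have key : v / s = i ↔ s * i ≤ v ∧ v < s * i + s := by
      rw [Nat.div_eq_iff hs, mul_comm]
      omega
    constructor
    · rintro ⟨x, hx, rfl⟩
      exact ⟨(key.1 hx).1, (key.1 hx).2, x.2⟩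
    · rintro ⟨h1, h2, h3⟩
      exact ⟨⟨v, h3⟩, key.2 ⟨h1, h2⟩, rfl⟩
  rw [hcard, Nat.card_Ico]
  omega

lemma bottlePart_surjective (hs : 0 < s) (hh : 0 < h) :
    Function.Surjective (bottlePart h s) := by
  intro i
  have hi : s * i ≤ h - 1 :=
    (Nat.mul_le_mul_left s (Nat.le_of_lt_succ i.2)).trans (Nat.mul_div_le _ _)
  exact ⟨⟨s * i, by omega⟩, Fin.ext (Nat.mul_div_cancel_left _ hs)⟩

lemma partsCard_bottlePart_last (hs : 0 < s) (hh : 0 < h) :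
    partsCard (bottlePart h s) {Fin.last _} + s * ((h - 1) / s) = h := by
  rw [partsCard_bottlePart_singleton hs, Fin.val_last]
  have := Nat.div_add_mod (h - 1) s
  have := Nat.mod_lt (h - 1) hs
  omega

lemma chromNum_comap_top {m k : ℕ} {p : Fin m → Fin k} (hp : Function.Surjective p) :
    chromNum (SimpleGraph.comap p (⊤ : SimpleGraph (Fin k))) = k := by
  have hmem : k ∈ {l | ∃ c : Fin m → Fin l, ∀ x y : Fin m,
      (SimpleGraph.comap p (⊤ : SimpleGraph (Fin k))).Adj x y → c x ≠ c y} :=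
    ⟨p, fun x y hxy => by simpa using hxy⟩
  refine le_antisymm (Nat.sInf_le hmem) ?_
  obtain ⟨c, hc⟩ := Nat.sInf_mem ⟨k, hmem⟩
  obtain ⟨g, hg⟩ := hp.hasRightInverse
  have hinj : Function.Injective (c ∘ g) := by
    intro i i' hii'
    by_contra hne
    exact hc (g i) (g i') (by simpa [hg i, hg i'] using hne) hii'
  have hcard := Fintype.card_le_of_injective _ hinj
  rwa [Fintype.card_fin, Fintype.card_fin] at hcard

lemma filter_eq_fibre_of_proper {m k : ℕ} {p : Fin m → Fin k} (hp : Function.Surjective p)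
    (C : Fin m → Fin k)
    (hC : ∀ x y, (SimpleGraph.comap p (⊤ : SimpleGraph (Fin k))).Adj x y → C x ≠ C y)
    (i : Fin k) :
    ∃ e, #{v | C v = i} = partsCard p {e} := by
  obtain ⟨g, hg⟩ := hp.hasRightInverse
  have hCp : ∀ x y, C x = C y → p x = p y := fun x y hxy => by
    by_contra hne
    exact hC x y (by simpa using hne) hxy
  have hinj : Function.Injective (C ∘ g) := fun e e' hee' => by
    simpa [hg e, hg e'] using hCp _ _ hee'
  have hsurj := Finite.injective_iff_surjective.1 hinj
  obtain ⟨e, rfl⟩ := hsurj i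
  refine ⟨e, ?_⟩
  unfold partsCard
  congr 1
  ext x
  simp only [mem_filter, mem_univ, true_and, mem_singleton, Function.comp_apply]
  constructor
  · intro hx
    rw [hCp _ _ hx, hg e]
  · rintro rfl
    obtain ⟨e', he'⟩ := hsurj (C x)
    have := hCp _ _ he'
    rw [hg e'] at this
    rw [← this]
    exact he'.symm

lemma sigmaMinCl_bottlePart (hs : 0 < s) (hh : 0 < h) :
    sigmaMinCl (SimpleGraph.comap (bottlePart h s) ⊤) =
      partsCard (bottlePart h s) {Fin.last _} := by
  have hsurj := bottlePart_surjective hs hh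
  unfold sigmaMinCl
  rw [chromNum_comap_top hsurj]
  refine IsLeast.csInf_eq ⟨⟨bottlePart h s, fun x y hxy => by simpa using hxy, Fin.last _, ?_⟩, ?_⟩
  · simp [partsCard]
  · rintro c ⟨C, hC, i, rfl⟩
    obtain ⟨e, he⟩ := filter_eq_fibre_of_proper hsurj C hC i
    rw [he, partsCard_bottlePart_singleton hs, partsCard_bottlePart_singleton hs]
    have := Nat.mul_le_mul_left s (Fin.le_last e)
    omega

lemma critChrom_bottlePart (hs : 0 < s) (hsh : s < h) :
    critChrom (SimpleGraph.comap (bottlePart h s) ⊤) = (h : ℝ) / s := by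
  have hh : 0 < h := by omega
  unfold critChrom
  rw [chromNum_comap_top (bottlePart_surjective hs hh), sigmaMinCl_bottlePart hs hh]
  have hlast := partsCard_bottlePart_last hs hh
  have hk : 0 < (h - 1) / s := Nat.div_pos (by omega) hs
  generalize partsCard (bottlePart h s) {Fin.last _} = r at *
  generalize (h - 1) / s = k at *
  have hcast : (h : ℝ) - r = s * k := by
    rw [sub_eq_iff_eq_add', ← hlast]
    push_cast
    rfl
  rw [hcast]
  push_cast
  rw [add_sub_cancel_right]
  field_simp

end BottleParts

section Alpha

variable {h : ℕ} {H : SimpleGraph (Fin h)}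

lemma alphaPlus_one_isGreatest (H : SimpleGraph (Fin h)) :
    IsGreatest {k | k ≤ h ∧ ∀ a b : Fin h, (a : ℕ) < k → (b : ℕ) < k → ¬ H.Adj a b}
      (alphaPlus H 1) := by
  have hset : {k | k ≤ h ∧ ∀ a b : Fin h, (a : ℕ) < k → (b : ℕ) < k → ¬ H.Adj a b} =
      {k | k ≤ h ∧ ∀ a b : Fin h,
      alphaPlus H 0 + 1 ≤ (a : ℕ) + 1 → (a : ℕ) + 1 ≤ k →
      alphaPlus H 0 + 1 ≤ (b : ℕ) + 1 → (b : ℕ) + 1 ≤ k → ¬ H.Adj a b} := by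
    simp [alphaPlus]
  rw [alphaPlus, hset]
  have hbdd : BddAbove {k | k ≤ h ∧ ∀ a b : Fin h,
      alphaPlus H 0 + 1 ≤ (a : ℕ) + 1 → (a : ℕ) + 1 ≤ k →
      alphaPlus H 0 + 1 ≤ (b : ℕ) + 1 → (b : ℕ) + 1 ≤ k → ¬ H.Adj a b} :=
    ⟨h, fun k hk => hk.1⟩
  exact ⟨Nat.sSup_mem ⟨0, by simp⟩ hbdd, fun k hk => le_csSup hbdd hk⟩

lemma alphaMinus_one_isLeast (H : SimpleGraph (Fin h)) :
    IsLeast {k | 1 ≤ k ∧ ∀ a b : Fin h, k ≤ (a : ℕ) + 1 → k ≤ (b : ℕ) + 1 → ¬ H.Adj a b}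
      (alphaMinus H 1) := by
  have hset : {k | 1 ≤ k ∧ ∀ a b : Fin h, k ≤ (a : ℕ) + 1 → k ≤ (b : ℕ) + 1 → ¬ H.Adj a b} =
      {k | 1 ≤ k ∧ ∀ a b : Fin h,
      k ≤ (a : ℕ) + 1 → (a : ℕ) + 1 ≤ alphaMinus H 0 - 1 →
      k ≤ (b : ℕ) + 1 → (b : ℕ) + 1 ≤ alphaMinus H 0 - 1 → ¬ H.Adj a b} := by
    simp [alphaMinus, Nat.succ_le_iff]
  rw [alphaMinus, hset]
  refine ⟨Nat.sInf_mem ⟨h + 1, ?_⟩, fun k hk => Nat.sInf_le hk⟩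
  rw [← hset]
  exact ⟨by omega, fun a b ha => by omega⟩

/-- If `χ<(H) = 2`, the extremal independent initial and final segments, of sizes `a` and `b`,
are proper and cover `[h]`, and all edges cross each cut between them. -/
lemma exists_alpha_sizes (hchi : intervalChi H = 2) :
    ∃ a b : ℕ, alphaPlus H 1 = a ∧ (h : ℝ) - alphaMinus H 1 + 1 = b ∧
      0 < a ∧ a < h ∧ 0 < b ∧ b < h ∧ h ≤ a + b ∧
      ∀ j ≤ a, h ≤ j + b → ∀ u v : Fin h, u < v → H.Adj u v → (u : ℕ) < j ∧ j ≤ v := by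
  obtain ⟨⟨hah, haind⟩, hamax⟩ := alphaPlus_one_isGreatest H
  obtain ⟨⟨hb1, hbind⟩, hbmin⟩ := alphaMinus_one_isLeast H
  have hcol : HasIntervalColoring H 2 := by
    rw [← hchi]
    exact Nat.sInf_mem (Nat.nonempty_of_pos_sInf (by change 0 < intervalChi H; omega))
  have hedge : ∃ u v, H.Adj u v := by
    by_contra! hno
    have : intervalChi H ≤ 1 :=
      Nat.sInf_le ⟨fun _ => 0, monotone_const, fun i j hij => absurd hij (hno i j)⟩
    omega
  obtain ⟨u₀, v₀, huv₀⟩ := hedge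
  obtain ⟨c, hcmono, hc⟩ := hcol
  have hne : ∃ j ≤ h, ∀ u : Fin h, c u = 0 ↔ (u : ℕ) < j := by
    by_cases hall : ∃ n, ∃ hn : n < h, c ⟨n, hn⟩ ≠ 0
    · classical
      obtain ⟨hlt, hne0⟩ := Nat.find_spec hall
      refine ⟨Nat.find hall, hlt.le, fun u => ⟨fun hu => ?_, fun hu => ?_⟩⟩
      · by_contra! hle
        have hle' : (⟨Nat.find hall, hlt⟩ : Fin h) ≤ u := hle
        have := hcmono hle'
        rw [hu] at this
        exact hne0 (Fin.le_zero_iff.1 this)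
      · by_contra hu0
        exact Nat.find_min hall hu ⟨u.2, hu0⟩
    · push Not at hall
      exact ⟨h, le_rfl, fun u => ⟨fun _ => u.2, fun _ => hall u u.2⟩⟩
  obtain ⟨j, hjh, hj⟩ := hne
  have hja : j ≤ alphaPlus H 1 := hamax ⟨hjh, fun u v hu hv hadj =>
    hc u v hadj (by rw [(hj u).2 hu, (hj v).2 hv])⟩
  have hjb : alphaMinus H 1 ≤ j + 1 := hbmin ⟨by omega, fun u v hu hv hadj => by
    have h1 := mt (hj u).1 (by omega)
    have h2 := mt (hj v).1 (by omega)
    exact hc u v hadj (by omega)⟩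
  have h0 : 1 ≤ alphaPlus H 1 := hamax ⟨by have := u₀.2; omega, fun u v hu hv hadj =>
    hadj.ne (Fin.ext (by omega))⟩
  have hlast : alphaMinus H 1 ≤ h := hbmin ⟨by have := u₀.2; omega, fun u v hu hv hadj =>
    hadj.ne (Fin.ext (by omega))⟩
  have hlt : alphaPlus H 1 ≠ h := fun he =>
    haind u₀ v₀ (by rw [he]; exact u₀.2) (by rw [he]; exact v₀.2) huv₀
  have hgt : alphaMinus H 1 ≠ 1 := fun he => hbind u₀ v₀ (by omega) (by omega) huv₀
  refine ⟨alphaPlus H 1, h + 1 - alphaMinus H 1, rfl, ?_, h0, by omega, by omega, by omega,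
    by omega, ?_⟩
  · rw [Nat.cast_sub (by omega)]
    push_cast
    ring
  · intro i hi hib u v huv hadj
    have huv' : (u : ℕ) < v := huv
    constructor
    · by_contra hcon
      exact hbind u v (by omega) (by omega) hadj
    · by_contra hcon
      exact haind u v (by omega) (by omega) hadj

end Alpha

section Main

variable {h s : ℕ}

/-- The tiling criterion for ordered blow-ups of the complete multipartite graph with parts
`bottlePart h s`: `L` and `w` are the numbers of vertices before and in a part. -/
lemma isBottlegraph_of_cut (H : SimpleGraph (Fin h))
    (hcut : ∀ σ : Equiv.Perm (Fin ((h - 1) / s + 1)), ∃ t > 0, ∃ j ≤ h,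
      (∀ u v : Fin h, u < v → H.Adj u v → (u : ℕ) < j ∧ j ≤ v) ∧
      ∀ c < t, ∀ e L w, partsCard (bottlePart h s) {i | σ i < σ e} = L →
        partsCard (bottlePart h s) {e} = w → t * L < (c + 1) * j →
        t * j + c * (h - j) < t * (L + w) → False) :
    IsBottlegraph H (bottlePart h s) := by
  rintro φ ⟨σ, hσ⟩
  obtain ⟨t, ht, j, hj, hH, hc⟩ := hcut σ
  refine ⟨t, ht, ?_⟩
  rintro N G ⟨β, hβ, hmono, hadj⟩
  have hN : N = t * h := by
    have := card_blowup (bottlePart h s) β hβ univ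
    rw [partsCard_univ] at this
    simpa using this
  refine hasPerfectTiling_of_cut H G hN hj hH fun c hct x y hx hy => (hadj x y).2 fun hxy => ?_
  obtain ⟨e, h1, h2⟩ := position_bounds _ φ σ hσ β hβ hmono x y hxy
  exact hc c hct e _ _ rfl rfl (by omega) (by omega)

lemma isBottlegraph_of_two_parts (H : SimpleGraph (Fin h)) (hsh : s < h) (h2s : h ≤ 2 * s)
    (hcut : ∀ j ≤ s, h ≤ j + s → ∀ u v : Fin h, u < v → H.Adj u v → (u : ℕ) < j ∧ j ≤ v) :
    IsBottlegraph H (bottlePart h s) := by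
  have hs : 0 < s := by omega
  refine isBottlegraph_of_cut H fun σ => ?_
  have hw := partsCard_bottlePart_singleton (h := h) hs (σ.symm 0)
  have hle : s * (σ.symm 0 : Fin ((h - 1) / s + 1)) ≤ s := by
    have h1 : (h - 1) / s < 2 := Nat.div_lt_of_lt_mul (by omega)
    have h2 := (σ.symm 0).2
    exact (Nat.mul_le_mul_left s (by omega : _ ≤ 1)).trans (by omega)
  refine ⟨1, one_pos, partsCard (bottlePart h s) {σ.symm 0}, by omega,
    hcut _ (by omega) (by omega), ?_⟩
  intro c hc e L w hL hw' h1 h2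
  obtain rfl : c = 0 := by omega
  rcases eq_or_ne (σ e) 0 with he | he
  · have : σ.symm 0 = e := by rw [← he, Equiv.symm_apply_apply]
    rw [this, hw'] at h2
    rw [he] at hL
    simp [partsCard_empty] at hL
    omega
  · have : partsCard (bottlePart h s) {σ.symm 0} ≤ L := by
      rw [← hL]
      apply partsCard_mono
      simpa using Fin.pos_iff_ne_zero.2 he
    omega

lemma isBottlegraph_of_left (H : SimpleGraph (Fin h)) (hs : 0 < s) (h2s : 2 * s ≤ h)
    (hcut : ∀ u v : Fin h, u < v → H.Adj u v → (u : ℕ) < s ∧ s ≤ v) :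
    IsBottlegraph H (bottlePart h s) := by
  refine isBottlegraph_of_cut H fun σ => ⟨s, hs, s, by omega, hcut, ?_⟩
  intro c hc e L w _ hw h1 h2
  have hws : w ≤ s := by
    rw [← hw, partsCard_bottlePart_singleton hs]
    exact min_le_left _ _
  obtain ⟨d, rfl⟩ := Nat.exists_eq_add_of_le h2s
  have hd : 2 * s + d - s = s + d := by omega
  rw [hd] at h2
  have hLc : L < c + 1 := by nlinarith
  nlinarith

lemma isBottlegraph_of_right (H : SimpleGraph (Fin h)) (hs : 0 < s) (h2s : 2 * s ≤ h)
    (hcut : ∀ u v : Fin h, u < v → H.Adj u v → (u : ℕ) < h - s ∧ h - s ≤ v) :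
    IsBottlegraph H (bottlePart h s) := by
  refine isBottlegraph_of_cut H fun σ => ⟨s, hs, h - s, by omega, hcut, ?_⟩
  intro c hc e L w _ hw h1 h2
  have hws : w ≤ s := by
    rw [← hw, partsCard_bottlePart_singleton hs]
    exact min_le_left _ _
  obtain ⟨d, rfl⟩ := Nat.exists_eq_add_of_le h2s
  have hd : 2 * s + d - s = s + d := by omega
  have hd' : 2 * s + d - (s + d) = s := by omega
  rw [hd] at h1 h2
  rw [hd'] at h2
  have hLc : s + d + c < L + w := by nlinarith
  nlinarith

end Main

theorem bottlegraph_for_interval_chromatic_two (h : ℕ) (H : SimpleGraph (Fin h))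
    (hchi : intervalChi H = 2) :
    ∃ (m k : ℕ) (p : Fin m → Fin k),
      (∀ i : Fin k, ∃ x : Fin m, p x = i) ∧
      IsBottlegraph H p ∧
      critChrom (SimpleGraph.comap p (⊤ : SimpleGraph (Fin k))) = 1 / alphaStar2 H := by
  obtain ⟨a, b, ha, hb, ha0, hah, hb0, hbh, hab, hcut⟩ := exists_alpha_sizes hchi
  have hs : 0 < min a b := by omega
  refine ⟨h, _, bottlePart h (min a b), bottlePart_surjective hs (by omega), ?_, ?_⟩
  · rcases le_total h (2 * min a b) with h2 | h2
    · exact isBottlegraph_of_two_parts H (by omega) h2 fun j hj hjs =>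
        hcut j (by omega) (by omega)
    · rcases le_total a b with hle | hle
      · rw [min_eq_left hle] at *
        exact isBottlegraph_of_left H ha0 h2 (hcut a le_rfl hab)
      · rw [min_eq_right hle] at *
        exact isBottlegraph_of_right H hb0 h2 (hcut (h - b) (by omega) (by omega))
  · rw [critChrom_bottlePart hs (by omega), alphaStar2, ha, hb, min_div_div_right (by positivity),
      one_div_div, Nat.cast_min]
end

section
/- Let H be an ordered graph on h vertices with interval chromatic number χ<(H)=2. For every η>0 there exists n₀∈ℕ such that every ordered graph G on n ≥ n₀ vertices with minimum degree δ(G) ≥ (1 − α*(H) + η)n contains an H-tiling covering all but at most ηn vertices of G. -/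
open Finset

section Tiling

variable {h n : ℕ}

/-- A family of pairwise disjoint vertex sets of copies of `H` in `G`. -/
def IsOrderedTiling (H : SimpleGraph (Fin h)) (G : SimpleGraph (Fin n))
    (𝒯 : Finset (Finset (Fin n))) : Prop :=
  (∀ T ∈ 𝒯, IsCopySet H G T) ∧ (𝒯 : Set (Finset (Fin n))).PairwiseDisjoint id

lemma IsCopySet.card_eq {H : SimpleGraph (Fin h)} {G : SimpleGraph (Fin n)}
    {S : Finset (Fin n)} (hS : IsCopySet H G S) : S.card = h := by
  obtain ⟨φ, hφ, rfl⟩ := hS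
  rw [Finset.card_image_of_injective _ hφ.1.injective, Finset.card_univ, Fintype.card_fin]

/-- If every edge of `H` goes from `[1, s]` to `[a + 1, h]` and `s ≤ p ≤ a`, then a complete pair
`P < Q` with `|P| = p` and `|P| + |Q| = h` spans a copy of `H`. -/
lemma isCopySet_union {H : SimpleGraph (Fin h)} {G : SimpleGraph (Fin n)} {s a p q : ℕ}
    (hH : ∀ i j : Fin h, H.Adj i j → i < j → (i : ℕ) < s ∧ a ≤ (j : ℕ))
    (hsp : s ≤ p) (hpa : p ≤ a) (hpq : p + q = h) {P Q : Finset (Fin n)}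
    (hP : P.card = p) (hQ : Q.card = q) (hPQ : ∀ x ∈ P, ∀ y ∈ Q, x < y ∧ G.Adj x y) :
    IsCopySet H G (P ∪ Q) := by
  classical
  let φ : Fin h → Fin n := fun i =>
    if hi : (i : ℕ) < p then P.orderEmbOfFin hP ⟨i, hi⟩
    else Q.orderEmbOfFin hQ ⟨i - p, by omega⟩
  have hlow : ∀ i : Fin h, (i : ℕ) < p → φ i ∈ P := by
    intro i hi
    simp only [φ, hi, dif_pos]
    exact Finset.orderEmbOfFin_mem _ _ _
  have hhigh : ∀ i : Fin h, ¬ (i : ℕ) < p → φ i ∈ Q := by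
    intro i hi
    simp only [φ, hi, dif_neg, not_false_eq_true]
    exact Finset.orderEmbOfFin_mem _ _ _
  have hmono : StrictMono φ := by
    intro i j hij
    have hij' : (i : ℕ) < j := hij
    by_cases hi : (i : ℕ) < p
    · by_cases hj : (j : ℕ) < p
      · simp only [φ, hi, hj, dif_pos]
        exact (P.orderEmbOfFin hP).strictMono hij'
      · exact (hPQ _ (hlow i hi) _ (hhigh j hj)).1
    · have hj : ¬ (j : ℕ) < p := by omega
      simp only [φ, hi, hj, dif_neg, not_false_eq_true]
      apply (Q.orderEmbOfFin hQ).strictMono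
      rw [Fin.mk_lt_mk]
      omega
  have hadj : ∀ i j : Fin h, H.Adj i j → i < j → G.Adj (φ i) (φ j) := by
    intro i j hij hlt
    obtain ⟨h1, h2⟩ := hH i j hij hlt
    exact (hPQ _ (hlow i (by omega)) _ (hhigh j (by omega))).2
  refine ⟨φ, ⟨hmono, fun i j hij => ?_⟩, ?_⟩
  · rcases lt_or_gt_of_ne hij.ne with hlt | hlt
    · exact hadj i j hij hlt
    · exact (hadj j i hij.symm hlt).symm
  · apply Finset.eq_of_subset_of_card_le
    · intro x hx
      obtain ⟨i, -, rfl⟩ := Finset.mem_image.1 hx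
      by_cases hi : (i : ℕ) < p
      · exact Finset.mem_union_left _ (hlow i hi)
      · exact Finset.mem_union_right _ (hhigh i hi)
    · rw [Finset.card_image_of_injective _ hmono.injective, Finset.card_univ, Fintype.card_fin]
      exact (Finset.card_union_le _ _).trans (by omega)

lemma IsOrderedTiling.union {H : SimpleGraph (Fin h)} {G : SimpleGraph (Fin n)}
    {𝒜 ℬ : Finset (Finset (Fin n))} (h𝒜 : IsOrderedTiling H G 𝒜) (hℬ : IsOrderedTiling H G ℬ)
    (hd : ∀ A ∈ 𝒜, ∀ B ∈ ℬ, Disjoint A B) : IsOrderedTiling H G (𝒜 ∪ ℬ) := by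
  classical
  refine ⟨fun T hT => ?_, ?_⟩
  · rcases Finset.mem_union.1 hT with hT | hT
    · exact h𝒜.1 T hT
    · exact hℬ.1 T hT
  · rw [Finset.coe_union, Set.pairwiseDisjoint_union]
    exact ⟨h𝒜.2, hℬ.2, fun A hA B hB _ => hd A hA B hB⟩

lemma IsOrderedTiling.card_union {H : SimpleGraph (Fin h)} {G : SimpleGraph (Fin n)}
    (hh : 0 < h) {𝒜 ℬ : Finset (Finset (Fin n))} (h𝒜 : IsOrderedTiling H G 𝒜)
    (hd : ∀ A ∈ 𝒜, ∀ B ∈ ℬ, Disjoint A B) : (𝒜 ∪ ℬ).card = 𝒜.card + ℬ.card := by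
  classical
  apply Finset.card_union_of_disjoint
  rw [Finset.disjoint_left]
  intro T hT hT'
  have h0 : T = ∅ := by simpa using hd T hT T hT'
  have h1 := (h𝒜.1 T hT).card_eq
  rw [h0, Finset.card_empty] at h1
  omega

/-- Greedily tiling a pair in which all pairs of subsets of prescribed sizes span copies. -/
lemma exists_tiling_of_pair {H : SimpleGraph (Fin h)} {G : SimpleGraph (Fin n)} (hh : 0 < h)
    {p q : ℕ} (r : ℕ) : ∀ X Y : Finset (Fin n), Disjoint X Y →
    (∀ P ⊆ X, ∀ Q ⊆ Y, P.card = p → Q.card = q → IsCopySet H G (P ∪ Q)) →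
    r * p ≤ X.card → r * q ≤ Y.card →
    ∃ 𝒩 : Finset (Finset (Fin n)), IsOrderedTiling H G 𝒩 ∧ 𝒩.card = r ∧
      ∀ T ∈ 𝒩, T ⊆ X ∪ Y := by
  classical
  induction r with
  | zero =>
    intro X Y _ _ _ _
    exact ⟨∅, ⟨by simp, by simp⟩, rfl, by simp⟩
  | succ r ih =>
    intro X Y hXY hcopy hX hY
    rw [Nat.succ_mul] at hX hY
    obtain ⟨P, hPX, hP⟩ := Finset.exists_subset_card_eq (show p ≤ X.card by omega)
    obtain ⟨Q, hQY, hQ⟩ := Finset.exists_subset_card_eq (show q ≤ Y.card by omega)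
    obtain ⟨𝒩, h𝒩, hcard, hsub⟩ := ih (X \ P) (Y \ Q)
      (hXY.mono Finset.sdiff_subset Finset.sdiff_subset)
      (fun P' hP' Q' hQ' => hcopy P' (hP'.trans Finset.sdiff_subset) Q'
        (hQ'.trans Finset.sdiff_subset))
      (by rw [Finset.card_sdiff_of_subset hPX]; omega)
      (by rw [Finset.card_sdiff_of_subset hQY]; omega)
    have hnew : IsOrderedTiling H G {P ∪ Q} :=
      ⟨by simpa using hcopy P hPX Q hQY hP hQ, by simp⟩
    have hd : ∀ A ∈ 𝒩, ∀ B ∈ ({P ∪ Q} : Finset (Finset (Fin n))), Disjoint A B := by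
      intro A hA B hB
      rw [Finset.mem_singleton] at hB
      subst hB
      rw [Finset.disjoint_left] at hXY ⊢
      intro x hx hx'
      have h1 := hsub A hA hx
      simp only [Finset.mem_union, Finset.mem_sdiff] at h1 hx'
      rcases h1 with h1 | h1 <;> rcases hx' with h2 | h2
      · exact h1.2 h2
      · exact hXY h1.1 (hQY h2)
      · exact hXY (hPX h2) h1.1
      · exact h1.2 h2
    refine ⟨𝒩 ∪ {P ∪ Q}, h𝒩.union hnew hd, ?_, ?_⟩
    · rw [h𝒩.card_union hh hd, hcard, Finset.card_singleton]
    · intro T hT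
      rcases Finset.mem_union.1 hT with hT | hT
      · exact (hsub T hT).trans (Finset.union_subset_union Finset.sdiff_subset Finset.sdiff_subset)
      · rw [Finset.mem_singleton.1 hT]
        exact Finset.union_subset_union hPX hQY

/-- A finite set can be covered by about `|S| / c` subsets of size at most `c`. -/
lemma exists_cover_card_le {α : Type*} [DecidableEq α] {c : ℕ} (hc : 0 < c) (S : Finset α) :
    ∃ 𝒞 : Finset (Finset α), (∀ P ∈ 𝒞, P ⊆ S ∧ P.card ≤ c) ∧ (∀ x ∈ S, ∃ P ∈ 𝒞, x ∈ P) ∧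
      𝒞.card ≤ S.card / c + 1 := by
  induction hN : S.card using Nat.strong_induction_on generalizing S with
  | _ N ih =>
    by_cases hS : N < c
    · exact ⟨{S}, by simp; omega, by simp, by simp⟩
    · obtain ⟨P, hPS, hP⟩ := Finset.exists_subset_card_eq (show c ≤ S.card by omega)
      have hcard : (S \ P).card = N - c := by
        rw [Finset.card_sdiff_of_subset hPS, hN, hP]
      obtain ⟨𝒞, h1, h2, h3⟩ := ih (N - c) (by omega) (S \ P) hcard
      refine ⟨insert P 𝒞, ?_, ?_, ?_⟩
      · intro Q hQ
        rcases Finset.mem_insert.1 hQ with rfl | hQ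
        · exact ⟨hPS, hP.le⟩
        · exact ⟨(h1 Q hQ).1.trans Finset.sdiff_subset, (h1 Q hQ).2⟩
      · intro x hx
        by_cases hxP : x ∈ P
        · exact ⟨P, Finset.mem_insert_self _ _, hxP⟩
        · obtain ⟨Q, hQ, hxQ⟩ := h2 x (Finset.mem_sdiff.2 ⟨hx, hxP⟩)
          exact ⟨Q, Finset.mem_insert_of_mem hQ, hxQ⟩
      · refine (Finset.card_insert_le _ _).trans ?_
        have : N / c = (N - c) / c + 1 := by
          rw [← Nat.add_div_right _ hc]
          congr 1
          omega
        omega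

lemma IsOrderedTiling.card_biUnion {H : SimpleGraph (Fin h)} {G : SimpleGraph (Fin n)}
    {𝒯 : Finset (Finset (Fin n))} (h𝒯 : IsOrderedTiling H G 𝒯) :
    (𝒯.biUnion id).card = 𝒯.card * h := by
  rw [Finset.card_biUnion h𝒯.2]
  exact Finset.sum_const_nat fun T hT => (h𝒯.1 T hT).card_eq

/-- The vertex set can be covered by about `n / (h * M)` sets of size at most `h * M`, each of
which meets at most `M` tiles. -/
lemma IsOrderedTiling.exists_cover {H : SimpleGraph (Fin h)} {G : SimpleGraph (Fin n)}
    (hh : 0 < h) {𝒯 : Finset (Finset (Fin n))} (h𝒯 : IsOrderedTiling H G 𝒯) {M : ℕ}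
    (hM : 0 < M) :
    ∃ 𝒲 : Finset (Finset (Fin n)), (∀ v, ∃ W ∈ 𝒲, v ∈ W) ∧ (∀ W ∈ 𝒲, W.card ≤ h * M) ∧
      (∀ W ∈ 𝒲, (𝒯.filter fun T => ¬ Disjoint T W).card ≤ M) ∧
      𝒲.card * (h * M) ≤ n + 2 * (h * M) := by
  classical
  set U : Finset (Fin n) := (𝒯.biUnion id)ᶜ with hU
  obtain ⟨𝒞, hP1, hP2, hP3⟩ := exists_cover_card_le hM 𝒯
  obtain ⟨𝒬, hQ1, hQ2, hQ3⟩ := exists_cover_card_le (Nat.mul_pos hh hM) U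
  have hUcard : 𝒯.card * h + U.card = n := by
    rw [← h𝒯.card_biUnion, hU, Finset.card_add_card_compl, Fintype.card_fin]
  refine ⟨𝒞.image (fun P => P.biUnion id) ∪ 𝒬, ?_, ?_, ?_, ?_⟩
  · intro v
    by_cases hv : v ∈ U
    · obtain ⟨Q, hQ, hvQ⟩ := hQ2 v hv
      exact ⟨Q, Finset.mem_union_right _ hQ, hvQ⟩
    · rw [hU, Finset.mem_compl, not_not, Finset.mem_biUnion] at hv
      obtain ⟨T, hT, hvT⟩ := hv
      obtain ⟨P, hP, hTP⟩ := hP2 T hT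
      exact ⟨_, Finset.mem_union_left _ (Finset.mem_image_of_mem _ hP),
        Finset.mem_biUnion.2 ⟨T, hTP, hvT⟩⟩
  · intro W hW
    rcases Finset.mem_union.1 hW with hW | hW
    · obtain ⟨P, hP, rfl⟩ := Finset.mem_image.1 hW
      have hcard := Finset.card_biUnion_le_card_mul P id h
        (fun T hT => ((h𝒯.1 T ((hP1 P hP).1 hT)).card_eq).le)
      calc _ ≤ P.card * h := hcard
        _ ≤ M * h := Nat.mul_le_mul_right _ (hP1 P hP).2
        _ = h * M := Nat.mul_comm _ _
    · exact (hQ1 W hW).2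
  · intro W hW
    rcases Finset.mem_union.1 hW with hW | hW
    · obtain ⟨P, hP, rfl⟩ := Finset.mem_image.1 hW
      refine (Finset.card_le_card fun T hT => ?_).trans (hP1 P hP).2
      rw [Finset.mem_filter, Finset.disjoint_biUnion_right] at hT
      obtain ⟨hT, hTd⟩ := hT
      push Not at hTd
      obtain ⟨T', hT', hd⟩ := hTd
      have : T = T' := by
        by_contra hne
        exact hd (h𝒯.2 hT ((hP1 P hP).1 hT') hne)
      exact this ▸ hT'
    · rw [Finset.filter_false_of_mem]
      · simp
      · intro T hT
        rw [not_not, Finset.disjoint_left]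
        intro x hx hxW
        have := (hQ1 W hW).1 hxW
        rw [hU, Finset.mem_compl] at this
        exact this (Finset.mem_biUnion.2 ⟨T, hT, hx⟩)
  · have h1 : (𝒞.image (fun P => P.biUnion id) ∪ 𝒬).card ≤
        (𝒯.card / M + 1) + (U.card / (h * M) + 1) :=
      (Finset.card_union_le _ _).trans
        (Nat.add_le_add (Finset.card_image_le.trans hP3) hQ3)
    have h2 : 𝒯.card / M * M ≤ 𝒯.card := Nat.div_mul_le_self _ _
    have h3 : U.card / (h * M) * (h * M) ≤ U.card := Nat.div_mul_le_self _ _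
    calc _ ≤ ((𝒯.card / M + 1) + (U.card / (h * M) + 1)) * (h * M) := Nat.mul_le_mul_right _ h1
      _ = (𝒯.card / M * M) * h + U.card / (h * M) * (h * M) + 2 * (h * M) := by ring
      _ ≤ 𝒯.card * h + U.card + 2 * (h * M) := by gcongr
      _ = _ := by rw [hUcard]

/-- If many uncovered vertices have at least `m * (M + 2)` neighbours in a set `W` that meets at
most `M` tiles, then the tiling can be enlarged. -/
lemma IsOrderedTiling.exists_card_lt {H : SimpleGraph (Fin h)} {G : SimpleGraph (Fin n)}
    [DecidableRel G.Adj] {s a m M : ℕ}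
    (hH : ∀ i j : Fin h, H.Adj i j → i < j → (i : ℕ) < s ∧ a ≤ (j : ℕ))
    (hsa : s ≤ a) (hah : a ≤ h) (hm : 0 < m) (hsm : s ≤ m) (ham : h - a ≤ m) (hh : 0 < h)
    {𝒯 : Finset (Finset (Fin n))} (h𝒯 : IsOrderedTiling H G 𝒯) {W A : Finset (Fin n)}
    (hW : W.card ≤ h * M) (hWM : (𝒯.filter fun T => ¬ Disjoint T W).card ≤ M)
    (hA𝒯 : ∀ T ∈ 𝒯, Disjoint T A)
    (hAdeg : ∀ u ∈ A, m * (M + 2) ≤ (W.filter (G.Adj u)).card)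
    (hA : 4 ^ (h * M) * (2 * (h * (h * M))) < A.card) :
    ∃ 𝒯' : Finset (Finset (Fin n)), IsOrderedTiling H G 𝒯' ∧ 𝒯.card < 𝒯'.card := by
  classical
  let f : Fin n → Finset (Fin n) × Finset (Fin n) :=
    fun u => (W.filter (G.Adj u), W.filter (· < u))
  obtain ⟨⟨X, Z⟩, -, hfib⟩ :=
    Finset.exists_lt_card_fiber_of_mul_lt_card_of_maps_to (s := A)
      (t := W.powerset ×ˢ W.powerset) (f := f) (n := 2 * (h * (h * M)))
      (fun u _ => Finset.mem_product.2 ⟨Finset.mem_powerset.2 (Finset.filter_subset _ _),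
        Finset.mem_powerset.2 (Finset.filter_subset _ _)⟩) (by
        refine lt_of_le_of_lt (Nat.mul_le_mul_right _ ?_) hA
        rw [Finset.card_product, Finset.card_powerset, ← Nat.mul_pow]
        exact Nat.pow_le_pow_right (by norm_num) hW)
  set B := A.filter fun u => f u = (X, Z) with hB
  have hBA : B ⊆ A := Finset.filter_subset _ _
  have hBX : ∀ u ∈ B, W.filter (G.Adj u) = X := fun u hu =>
    congrArg Prod.fst (Finset.mem_filter.1 hu).2
  have hBZ : ∀ u ∈ B, W.filter (· < u) = Z := fun u hu =>
    congrArg Prod.snd (Finset.mem_filter.1 hu).2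
  obtain ⟨u₀, hu₀⟩ : B.Nonempty := Finset.card_pos.1 (by omega)
  have hXW : X ⊆ W := hBX u₀ hu₀ ▸ Finset.filter_subset _ _
  have hXcard : m * (M + 2) ≤ X.card := hBX u₀ hu₀ ▸ hAdeg u₀ (hBA hu₀)
  have hadj : ∀ x ∈ X, ∀ u ∈ B, G.Adj u x := fun x hx u hu =>
    (Finset.mem_filter.1 ((hBX u hu).symm ▸ hx)).2
  have hXB : Disjoint X B :=
    Finset.disjoint_left.2 fun x hx hxB => (hadj x hx x hxB).ne rfl
  have hL : ∀ x ∈ X ∩ Z, ∀ u ∈ B, x < u := by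
    intro x hx u hu
    have hxZ := (Finset.mem_inter.1 hx).2
    rw [← hBZ u hu] at hxZ
    exact (Finset.mem_filter.1 hxZ).2
  have hR : ∀ x ∈ X \ Z, ∀ u ∈ B, u < x := by
    intro x hx u hu
    obtain ⟨hxX, hxZ⟩ := Finset.mem_sdiff.1 hx
    rcases lt_or_gt_of_ne (hadj x hxX u hu).ne with hlt | hlt
    · exact hlt
    · rw [← hBZ u hu] at hxZ
      exact absurd (Finset.mem_filter.2 ⟨hXW hxX, hlt⟩) hxZ
  have hsplit : (X ∩ Z).card + (X \ Z).card = X.card := Finset.card_inter_add_card_sdiff X Z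
  obtain ⟨B₁, hB₁, hB₁c⟩ := Finset.exists_subset_card_eq
    (show h * (h * M) ≤ B.card by omega)
  have hB₂ : B \ B₁ ⊆ B := Finset.sdiff_subset
  have hB₂c : h * (h * M) ≤ (B \ B₁).card := by
    rw [Finset.card_sdiff_of_subset hB₁]; omega
  have hXD : X.card ≤ h * M := (Finset.card_le_card hXW).trans hW
  have hr : ∀ c ≤ h, ∀ y ≤ X.card, y / m * c ≤ h * (h * M) := by
    intro c hc y hy
    rw [Nat.mul_comm h (h * M)]
    exact Nat.mul_le_mul ((Nat.div_le_self _ _).trans (hy.trans hXD)) hc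
  obtain ⟨𝒩₁, h𝒩₁, hc₁, hs₁⟩ := exists_tiling_of_pair (H := H) (G := G) hh (p := s) (q := h - s)
    ((X ∩ Z).card / m) (X ∩ Z) B₁ (hXB.mono Finset.inter_subset_left hB₁)
    (fun P hP Q hQ hPc hQc => isCopySet_union hH le_rfl hsa (by omega) hPc hQc
      fun x hx y hy => ⟨hL x (hP hx) y (hB₁ (hQ hy)),
        (hadj x (Finset.inter_subset_left (hP hx)) y (hB₁ (hQ hy))).symm⟩)
    ((Nat.mul_le_mul_left _ hsm).trans (Nat.div_mul_le_self _ _))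
    ((hr _ (by omega) _ (by omega)).trans hB₁c.ge)
  obtain ⟨𝒩₂, h𝒩₂, hc₂, hs₂⟩ := exists_tiling_of_pair (H := H) (G := G) hh (p := h - a) (q := a)
    ((X \ Z).card / m) (X \ Z) (B \ B₁) (hXB.mono Finset.sdiff_subset hB₂)
    (fun P hP Q hQ hPc hQc => by
      rw [Finset.union_comm]
      exact isCopySet_union hH hsa le_rfl (by omega) hQc hPc
        fun y hy x hx => ⟨hR x (hP hx) y (hB₂ (hQ hy)),
          hadj x (Finset.sdiff_subset (hP hx)) y (hB₂ (hQ hy))⟩)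
    ((Nat.mul_le_mul_left _ ham).trans (Nat.div_mul_le_self _ _))
    ((hr _ hah _ (by omega)).trans hB₂c)
  have hd₁₂ : ∀ S ∈ 𝒩₁, ∀ T ∈ 𝒩₂, Disjoint S T := by
    intro S hS T hT
    refine Finset.disjoint_of_subset_left (hs₁ S hS)
      (Finset.disjoint_of_subset_right (hs₂ T hT) ?_)
    rw [Finset.disjoint_union_left, Finset.disjoint_union_right, Finset.disjoint_union_right]
    refine ⟨⟨?_, hXB.mono Finset.inter_subset_left hB₂⟩,
      (hXB.mono Finset.sdiff_subset hB₁).symm, Finset.disjoint_sdiff⟩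
    exact (Finset.disjoint_sdiff_inter X Z).symm
  have h𝒩 := h𝒩₁.union h𝒩₂ hd₁₂
  have h𝒩s : ∀ T ∈ 𝒩₁ ∪ 𝒩₂, T ⊆ W ∪ A := by
    intro T hT
    rcases Finset.mem_union.1 hT with hT | hT
    · exact (hs₁ T hT).trans (Finset.union_subset_union
        (Finset.inter_subset_left.trans hXW) (hB₁.trans hBA))
    · exact (hs₂ T hT).trans (Finset.union_subset_union
        (Finset.sdiff_subset.trans hXW) (hB₂.trans hBA))
  have h𝒪 : IsOrderedTiling H G (𝒯.filter fun T => Disjoint T W) :=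
    ⟨fun T hT => h𝒯.1 T (Finset.mem_filter.1 hT).1,
      h𝒯.2.subset (Finset.coe_subset.2 (Finset.filter_subset _ _))⟩
  have hd : ∀ S ∈ 𝒯.filter (fun T => Disjoint T W), ∀ T ∈ 𝒩₁ ∪ 𝒩₂, Disjoint S T := by
    intro S hS T hT
    obtain ⟨hS, hSW⟩ := Finset.mem_filter.1 hS
    exact Finset.disjoint_of_subset_right (h𝒩s T hT)
      (Finset.disjoint_union_right.2 ⟨hSW, hA𝒯 S hS⟩)
  refine ⟨_, h𝒪.union h𝒩 hd, ?_⟩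
  rw [h𝒪.card_union hh hd, h𝒩₁.card_union hh hd₁₂, hc₁, hc₂]
  have hpart := Finset.card_filter_add_card_filter_not (s := 𝒯) (fun T => Disjoint T W)
  have hgain : M < (X ∩ Z).card / m + (X \ Z).card / m := by
    have e₁ := Nat.lt_div_mul_add (a := (X ∩ Z).card) hm
    have e₂ := Nat.lt_div_mul_add (a := (X \ Z).card) hm
    refine Nat.lt_of_mul_lt_mul_left (a := m) ?_
    nlinarith
  omega

/-- A vertex of large degree has large degree into many members of a family covering the vertex
set. -/
lemma card_filter_adj_le (G : SimpleGraph (Fin n)) [DecidableRel G.Adj]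
    {𝒲 : Finset (Finset (Fin n))} {D τ : ℕ} (hcov : ∀ v, ∃ W ∈ 𝒲, v ∈ W)
    (hD : ∀ W ∈ 𝒲, W.card ≤ D) (u : Fin n) :
    odeg G u ≤ (𝒲.filter fun W => τ ≤ (W.filter (G.Adj u)).card).card * D + 𝒲.card * τ := by
  classical
  have h1 : odeg G u ≤ ∑ W ∈ 𝒲, (W.filter (G.Adj u)).card := by
    have : G.neighborSet u = ((𝒲.biUnion fun W => W.filter (G.Adj u) : Finset (Fin n)) :
        Set (Fin n)) := by
      ext v
      simp only [SimpleGraph.mem_neighborSet, Finset.coe_biUnion, Finset.mem_coe,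
        Finset.coe_filter, Set.mem_iUnion, Set.mem_ofPred_eq, exists_prop]
      refine ⟨fun hv => ?_, fun ⟨_, _, _, hv⟩ => hv⟩
      obtain ⟨W, hW, hvW⟩ := hcov v
      exact ⟨W, hW, hvW, hv⟩
    rw [odeg, this, Set.ncard_coe_finset]
    exact Finset.card_biUnion_le
  refine h1.trans ?_
  rw [← Finset.sum_filter_add_sum_filter_not 𝒲 fun W => τ ≤ (W.filter (G.Adj u)).card]
  refine Nat.add_le_add ?_ ?_
  · rw [← smul_eq_mul]
    exact Finset.sum_le_card_nsmul _ _ _ fun W hW =>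
      (Finset.card_filter_le _ _).trans (hD W (Finset.mem_filter.1 hW).1)
  · refine (Finset.sum_le_card_nsmul _ _ τ fun W hW => ?_).trans ?_
    · exact (not_le.1 (Finset.mem_filter.1 hW).2).le
    · rw [smul_eq_mul]
      exact Nat.mul_le_mul_right _ (Finset.card_filter_le _ _)

/-- A graph with interval chromatic number two has its edges between an initial and a final
interval, whose lengths determine `α*`. -/
lemma exists_edge_intervals {H : SimpleGraph (Fin h)} (hchi : intervalChi H = 2) :
    ∃ s a : ℕ, 0 < s ∧ s ≤ a ∧ a ≤ h ∧
      (∀ i j : Fin h, H.Adj i j → i < j → (i : ℕ) < s ∧ a ≤ (j : ℕ)) ∧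
      1 - alphaStar2 H = ((max s (h - a) : ℕ) : ℝ) / h := by
  have hmem : HasIntervalColoring H 2 := by
    have := Nat.sInf_mem (s := {k | HasIntervalColoring H k})
      (Nat.nonempty_of_pos_sInf (by
        change 0 < intervalChi H
        omega))
    change HasIntervalColoring H (intervalChi H) at this
    rwa [hchi] at this
  have hnot : ¬ HasIntervalColoring H 1 := by
    have : 1 ∉ {k | HasIntervalColoring H k} := Nat.notMem_of_lt_sInf (by
      change 1 < intervalChi H
      omega)
    exact this
  obtain ⟨x, y, hxy⟩ : ∃ x y : Fin h, H.Adj x y := by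
    by_contra! hno
    exact hnot ⟨fun _ => 0, monotone_const, fun i j hij => absurd hij (hno i j)⟩
  obtain ⟨c, hc, hcH⟩ := hmem
  have hplus : alphaPlus H 1 ∈ {k | k ≤ h ∧ ∀ a b : Fin h,
      alphaPlus H 0 + 1 ≤ (a : ℕ) + 1 → (a : ℕ) + 1 ≤ k →
      alphaPlus H 0 + 1 ≤ (b : ℕ) + 1 → (b : ℕ) + 1 ≤ k → ¬ H.Adj a b} :=
    Nat.sSup_mem ⟨0, by simp⟩ ⟨h, fun k hk => hk.1⟩
  have hminus : alphaMinus H 1 ∈ {k | 1 ≤ k ∧ ∀ a b : Fin h,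
      k ≤ (a : ℕ) + 1 → (a : ℕ) + 1 ≤ alphaMinus H 0 - 1 →
      k ≤ (b : ℕ) + 1 → (b : ℕ) + 1 ≤ alphaMinus H 0 - 1 → ¬ H.Adj a b} := by
    refine Nat.sInf_mem ⟨h + 1, by omega, fun a b h1 => ?_⟩
    have := a.2
    omega
  -- the length of the first colour class lies between the two interval bounds
  have hmid : alphaMinus H 1 ≤ alphaPlus H 1 + 1 := by
    set p := (Finset.univ.filter fun i : Fin h => c i = 0).card with hp
    have hph : p ≤ h := by
      simpa using Finset.card_filter_le (Finset.univ : Finset (Fin h)) fun i => c i = 0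
    have hlow : ∀ i : Fin h, (i : ℕ) < p ↔ c i = 0 := by
      intro i
      constructor
      · intro hi
        by_contra hne
        have hsub : (Finset.univ.filter fun i : Fin h => c i = 0) ⊆ Finset.Iio i := by
          intro j hj
          rw [Finset.mem_Iio]
          by_contra hle
          have h1 := hc (not_lt.1 hle)
          rw [(Finset.mem_filter.1 hj).2] at h1
          exact hne (Fin.le_zero_iff.1 h1)
        have := Finset.card_le_card hsub
        rw [Fin.card_Iio] at this
        omega
      · intro hi
        have hsub : Finset.Iic i ⊆ Finset.univ.filter fun i : Fin h => c i = 0 := by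
          intro j hj
          have h1 := hc (Finset.mem_Iic.1 hj)
          rw [hi] at h1
          simpa using Fin.le_zero_iff.1 h1
        have := Finset.card_le_card hsub
        rw [Fin.card_Iic] at this
        omega
    have h1 : p ≤ alphaPlus H 1 := by
      refine le_csSup (s := {k | k ≤ h ∧ _}) ⟨h, fun k hk => hk.1⟩ ⟨hph, ?_⟩
      intro i j _ hi _ hj hij
      exact hcH i j hij (((hlow i).1 hi).trans ((hlow j).1 hj).symm)
    have h2 : alphaMinus H 1 ≤ p + 1 := by
      refine Nat.sInf_le ⟨by omega, ?_⟩
      intro i j hi _ hj _ hij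
      have hi' : c i ≠ 0 := fun h0 => by have := (hlow i).2 h0; omega
      have hj' : c j ≠ 0 := fun h0 => by have := (hlow j).2 h0; omega
      have := hcH i j hij
      omega
    omega
  obtain ⟨hah, hind⟩ := hplus
  obtain ⟨hb1, hbind⟩ := hminus
  have h00 : alphaPlus H 0 = 0 := by simp [alphaPlus]
  have h01 : alphaMinus H 0 = h + 1 := by simp [alphaMinus]
  rw [h00] at hind
  rw [h01] at hbind
  have hedge : ∀ i j : Fin h, H.Adj i j → i < j →
      (i : ℕ) < alphaMinus H 1 - 1 ∧ alphaPlus H 1 ≤ (j : ℕ) := by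
    intro i j hij hlt
    have hlt' : (i : ℕ) < j := hlt
    have hi := i.2
    have hj := j.2
    constructor
    · by_contra hcon
      exact hbind i j (by omega) (by omega) (by omega) (by omega) hij
    · by_contra hcon
      exact hind i j (by omega) (by omega) (by omega) (by omega) hij
  refine ⟨alphaMinus H 1 - 1, alphaPlus H 1, ?_, by omega, hah, hedge, ?_⟩
  · rcases lt_or_gt_of_ne hxy.ne with hlt | hlt
    · have := (hedge x y hxy hlt).1
      omega
    · have := (hedge y x hxy.symm hlt).1
      omega
  · have hh : (0 : ℝ) < h := by
      have := x.2
      exact_mod_cast (by omega : 0 < h)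
    rw [alphaStar2, sub_eq_add_neg, ← max_neg_neg, ← max_add_add_left, Nat.cast_max,
      ← max_div_div_right hh.le, max_comm, Nat.cast_sub hb1, Nat.cast_sub hah]
    congr 1 <;> field_simp <;> push_cast <;> ring

end Tiling

theorem almost_perfect_tiling_interval_chromatic_two (h : ℕ) (H : SimpleGraph (Fin h))
    (hchi : intervalChi H = 2) (η : ℝ) (hη : 0 < η) :
    ∃ n₀ : ℕ, ∀ n : ℕ, n₀ ≤ n → ∀ G : SimpleGraph (Fin n),
      (∀ v : Fin n, (1 - alphaStar2 H + η) * n ≤ (odeg G v : ℝ)) →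
      ∃ S : Finset (Fin n), HasPerfectTilingOn H G S ∧ (n : ℝ) - S.card ≤ η * n := by
  classical
  obtain ⟨s, a, hs, hsa, hah, hH, hα⟩ := exists_edge_intervals hchi
  have hh : 0 < h := by omega
  have hhR : (0 : ℝ) < h := by exact_mod_cast hh
  set m := max s (h - a) with hm
  have hsm : s ≤ m := le_max_left _ _
  have ham : h - a ≤ m := le_max_right _ _
  have hm0 : 0 < m := by omega
  have hmh : m ≤ h := by omega
  obtain ⟨M, hM⟩ := exists_nat_gt (4 * m / (η * h))
  have hMR : (0 : ℝ) < M := lt_of_le_of_lt (by positivity) hM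
  have hM0 : 0 < M := by exact_mod_cast hMR
  rw [div_lt_iff₀ (by positivity)] at hM
  set D := h * M with hD
  have hDR : (0 : ℝ) < D := by exact_mod_cast Nat.mul_pos hh hM0
  set B := 4 ^ D * (2 * (h * D)) with hB
  set μ : ℝ := (m : ℝ) / h with hμ
  have hμ0 : 0 ≤ μ := by positivity
  have hμ1 : μ ≤ 1 := (div_le_one hhR).2 (by exact_mod_cast hmh)
  obtain ⟨n₁, hn₁⟩ := exists_nat_gt (8 * D * (1 + η) / η)
  obtain ⟨n₂, hn₂⟩ := exists_nat_gt (8 * B / η ^ 2)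
  refine ⟨max (max n₁ n₂) (2 * D), fun n hn G hG => ?_⟩
  have hnn₁ : (n₁ : ℝ) ≤ n := by
    exact_mod_cast (le_max_left _ _).trans ((le_max_left _ _).trans hn)
  have hnn₂ : (n₂ : ℝ) ≤ n := by
    exact_mod_cast (le_max_right _ _).trans ((le_max_left _ _).trans hn)
  have hnD : 2 * (D : ℝ) ≤ n := by exact_mod_cast (le_max_right _ _).trans hn
  have hn8 : 8 * D * (1 + η) < n * η := (div_lt_iff₀ hη).1 (hn₁.trans_le hnn₁)
  have hnB : 8 * B < n * η ^ 2 := (div_lt_iff₀ (by positivity)).1 (hn₂.trans_le hnn₂)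
  have hn0 : (0 : ℝ) < n := by linarith
  obtain ⟨𝒯, h𝒯, hmax⟩ := Finset.exists_max_image
    (Finset.univ.filter fun 𝒯 : Finset (Finset (Fin n)) => IsOrderedTiling H G 𝒯)
    Finset.card ⟨∅, Finset.mem_filter.2 ⟨Finset.mem_univ _, by simp, by simp⟩⟩
  replace h𝒯 : IsOrderedTiling H G 𝒯 := (Finset.mem_filter.1 h𝒯).2
  refine ⟨𝒯.biUnion id, ⟨𝒯, h𝒯.1, h𝒯.2, rfl⟩, ?_⟩
  by_contra! hlarge
  set U : Finset (Fin n) := (𝒯.biUnion id)ᶜ with hU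
  have hUcard : η * n < U.card := by
    rw [hU, Finset.card_compl, Fintype.card_fin, Nat.cast_sub]
    · exact hlarge
    · simpa using Finset.card_le_univ (𝒯.biUnion id)
  obtain ⟨𝒲, hcov, hWD, hWM, h𝒲⟩ := h𝒯.exists_cover hh hM0
  have hfew : ∀ W ∈ 𝒲, (U.filter fun u => m * (M + 2) ≤ (W.filter (G.Adj u)).card).card ≤ B := by
    intro W hW
    by_contra! hbig
    obtain ⟨𝒯', h𝒯', hlt⟩ := h𝒯.exists_card_lt hH hsa hah hm0 hsm ham hh (hWD W hW) (hWM W hW)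
      (A := U.filter fun u => m * (M + 2) ≤ (W.filter (G.Adj u)).card)
      (fun T hT => Finset.disjoint_left.2 fun x hx hxU =>
        Finset.mem_compl.1 (Finset.mem_filter.1 hxU).1 (Finset.mem_biUnion.2 ⟨T, hT, hx⟩))
      (fun u hu => (Finset.mem_filter.1 hu).2) hbig
    exact absurd (hmax 𝒯' (Finset.mem_filter.2 ⟨Finset.mem_univ _, h𝒯'⟩)) (by omega)
  have h𝒲R : (𝒲.card : ℝ) * D ≤ n + 2 * D := by exact_mod_cast h𝒲
  have hmany : ∀ u ∈ U, η * n / 4 ≤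
      ((𝒲.filter fun W => m * (M + 2) ≤ (W.filter (G.Adj u)).card).card : ℝ) * D := by
    intro u _
    have hdeg : (odeg G u : ℝ) ≤
        ((𝒲.filter fun W => m * (M + 2) ≤ (W.filter (G.Adj u)).card).card : ℝ) * D +
          𝒲.card * (m * (M + 2)) := by
      exact_mod_cast card_filter_adj_le G (τ := m * (M + 2)) hcov hWD u
    have hτ : (m : ℝ) * (M + 2) ≤ (μ + η / 2) * D := by
      have : μ * D = m * M := by rw [hμ, hD]; push_cast; field_simp
      have : η * D = M * (η * h) := by rw [hD]; push_cast; ring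
      nlinarith
    have h1 : (𝒲.card : ℝ) * (m * (M + 2)) ≤ (μ + η / 2) * (n + 2 * D) := by
      calc (𝒲.card : ℝ) * (m * (M + 2)) ≤ 𝒲.card * ((μ + η / 2) * D) := by gcongr
        _ = (μ + η / 2) * (𝒲.card * D) := by ring
        _ ≤ _ := by gcongr
    have h2 := hG u
    rw [hα] at h2
    have h3 : μ * D ≤ 1 * D := by gcongr
    nlinarith
  have hcount : ∑ u ∈ U, (𝒲.filter fun W => m * (M + 2) ≤ (W.filter (G.Adj u)).card).card ≤
      𝒲.card * B := by
    have := Finset.sum_card_bipartiteAbove_eq_sum_card_bipartiteBelow (s := U) (t := 𝒲)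
      fun u W => m * (M + 2) ≤ (W.filter (G.Adj u)).card
    simp only [Finset.bipartiteAbove, Finset.bipartiteBelow] at this
    rw [this, ← smul_eq_mul]
    exact Finset.sum_le_card_nsmul _ _ _ hfew
  have hcountR : (U.card : ℝ) * (η * n / 4) ≤ (𝒲.card * B : ℝ) * D := by
    calc (U.card : ℝ) * (η * n / 4) = ∑ _u ∈ U, η * n / 4 := by
          rw [Finset.sum_const, nsmul_eq_mul]
      _ ≤ ∑ u ∈ U, ((𝒲.filter fun W => m * (M + 2) ≤ (W.filter (G.Adj u)).card).card : ℝ) * D :=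
          Finset.sum_le_sum hmany
      _ = ((∑ u ∈ U, (𝒲.filter fun W => m * (M + 2) ≤ (W.filter (G.Adj u)).card).card : ℕ) : ℝ)
            * D := by
          rw [Nat.cast_sum, Finset.sum_mul]
      _ ≤ _ := by
          gcongr
          exact_mod_cast hcount
  have hupper : (𝒲.card * B : ℝ) * D ≤ 2 * n * B := by
    calc (𝒲.card * B : ℝ) * D = 𝒲.card * D * B := by ring
      _ ≤ (2 * n) * B := mul_le_mul_of_nonneg_right (by linarith) (Nat.cast_nonneg B)
  have hlower : η * n * (η * n / 4) ≤ U.card * (η * n / 4) := by gcongr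
  nlinarith
end

section
/- Let H be an ordered graph on h vertices with interval chromatic number χ<(H)=2 such that H has Property A, H does not have Property B, and neither the vertex 1 nor the vertex h has Property C. Then for every η>0 there exist n₀∈ℕ and ν>0 such that the following holds: if G is an ordered graph on vertex set [n] with n ≥ n₀ and minimum degree δ(G) ≥ ηn, then [n] contains a set Abs with |Abs| ≤ νn such that Abs is an H-absorbing set for every W ⊆ [n]∖Abs with |W| divisible by h and |W| ≤ ν³n. -/
open Finset

section Tilings

variable {h n : ℕ} {H : SimpleGraph (Fin h)} {G : SimpleGraph (Fin n)}

/-- `X` lies entirely before `Y`, and every vertex of `X` is adjacent to every vertex of `Y`. -/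
def IsOrderedBiclique (G : SimpleGraph (Fin n)) (X Y : Finset (Fin n)) : Prop :=
  ∀ x ∈ X, ∀ y ∈ Y, x < y ∧ G.Adj x y

lemma IsOrderedBiclique.mono {X Y X' Y' : Finset (Fin n)} (hXY : IsOrderedBiclique G X Y)
    (hX : X' ⊆ X) (hY : Y' ⊆ Y) : IsOrderedBiclique G X' Y' :=
  fun x hx y hy => hXY x (hX hx) y (hY hy)

lemma IsOrderedBiclique.disjoint {X Y : Finset (Fin n)} (hXY : IsOrderedBiclique G X Y) :
    Disjoint X Y :=
  Finset.disjoint_left.2 fun x hx hy => (hXY x hx x hy).1.false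

/-- The rank of the `i`-th element of a finite set is `i`. -/
lemma card_filter_lt_orderEmbOfFin {S : Finset (Fin n)} (hS : S.card = h) (i : Fin h) :
    (S.filter (· < S.orderEmbOfFin hS i)).card = i := by
  have : S.filter (· < S.orderEmbOfFin hS i) =
      (Finset.Iio i).map (S.orderEmbOfFin hS).toEmbedding := by
    ext u
    simp only [Finset.mem_filter, Finset.mem_map, Finset.mem_Iio]
    constructor
    · rintro ⟨hu, hlt⟩
      have : u ∈ Set.range (S.orderEmbOfFin hS) := by simpa using hu
      obtain ⟨j, rfl⟩ := this
      exact ⟨j, by simpa using hlt, rfl⟩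
    · rintro ⟨j, hj, rfl⟩
      exact ⟨S.orderEmbOfFin_mem hS j, by simpa using hj⟩
  rw [this]
  simp

lemma isCopySet_of_rank {S : Finset (Fin n)} (hS : S.card = h)
    (hadj : ∀ x ∈ S, ∀ y ∈ S, x < y → ∀ i j : Fin h, H.Adj i j → i < j →
      (S.filter (· < x)).card = i → (S.filter (· < y)).card = j → G.Adj x y) :
    IsCopySet H G S := by
  have key : ∀ i j : Fin h, H.Adj i j → i < j →
      G.Adj (S.orderEmbOfFin hS i) (S.orderEmbOfFin hS j) := fun i j hij hlt =>
    hadj _ (S.orderEmbOfFin_mem hS i) _ (S.orderEmbOfFin_mem hS j) (by simpa using hlt) i j hij hlt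
      (card_filter_lt_orderEmbOfFin hS i) (card_filter_lt_orderEmbOfFin hS j)
  refine ⟨S.orderEmbOfFin hS, ⟨(S.orderEmbOfFin hS).strictMono, fun i j hij => ?_⟩, ?_⟩
  · rcases lt_or_gt_of_ne hij.ne with hlt | hlt
    · exact key i j hij hlt
    · exact (key j i hij.symm hlt).symm
  · simp

lemma card_filter_lt_lt {S P : Finset (Fin n)} {x : Fin n} (hx : x ∈ P)
    (hP : ∀ u ∈ S, u < x → u ∈ P) : (S.filter (· < x)).card < P.card := by
  refine Finset.card_lt_card ((Finset.ssubset_iff_of_subset ?_).2 ⟨x, hx, by simp⟩)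
  intro u hu
  rw [Finset.mem_filter] at hu
  exact hP u hu.1 hu.2

lemma le_card_filter_lt {S P : Finset (Fin n)} {x : Fin n} (hPS : P ⊆ S)
    (hP : ∀ u ∈ P, u < x) : P.card ≤ (S.filter (· < x)).card :=
  Finset.card_le_card fun u hu => Finset.mem_filter.2 ⟨hPS hu, hP u hu⟩

lemma isCopySet_union_s9 {X Y : Finset (Fin n)} (hXY : IsOrderedBiclique G X Y)
    (hc : X.card + Y.card = h)
    (hcross : ∀ i j : Fin h, H.Adj i j → i < j → (i : ℕ) < X.card ∧ X.card ≤ j) :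
    IsCopySet H G (X ∪ Y) := by
  have hX : ∀ x ∈ X, ((X ∪ Y).filter (· < x)).card < X.card := fun x hx =>
    card_filter_lt_lt hx fun u hu hux => (Finset.mem_union.1 hu).resolve_right fun hy =>
      absurd (hXY x hx u hy).1 (not_lt.2 hux.le)
  have hY : ∀ y ∈ Y, X.card ≤ ((X ∪ Y).filter (· < y)).card := fun y hy =>
    le_card_filter_lt Finset.subset_union_left fun u hu => (hXY u hu y hy).1
  refine isCopySet_of_rank (by rw [Finset.card_union_of_disjoint hXY.disjoint, hc]) ?_
  intro x hx y hy hxy i j hij hlt hi hj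
  obtain ⟨h1, h2⟩ := hcross i j hij hlt
  rcases Finset.mem_union.1 hx with hx | hx
  · rcases Finset.mem_union.1 hy with hy | hy
    · have := hX y hy; omega
    · exact (hXY x hx y hy).2
  · have := hY x hx; omega

lemma isCopySet_insert_first {X Y : Finset (Fin n)} {z : Fin n} (hXY : IsOrderedBiclique G X Y)
    (hzX : ∀ x ∈ X, z < x) (hzY : ∀ y ∈ Y, z < y)
    (hc : X.card + Y.card + 1 = h)
    (hiso : ∀ i j : Fin h, H.Adj i j → (i : ℕ) ≠ 0)
    (hcross : ∀ i j : Fin h, H.Adj i j → i < j → (i : ℕ) < X.card + 1 ∧ X.card + 1 ≤ j) :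
    IsCopySet H G (insert z (X ∪ Y)) := by
  have hz : z ∉ X ∪ Y := fun hz => (Finset.mem_union.1 hz).elim
    (fun hx => (hzX z hx).false) (fun hy => (hzY z hy).false)
  have hzX' : z ∉ X := fun hx => hz (Finset.mem_union_left _ hx)
  have hXr : ∀ x ∈ X, ((insert z (X ∪ Y)).filter (· < x)).card < X.card + 1 := by
    intro x hx
    rw [← Finset.card_insert_of_notMem hzX']
    refine card_filter_lt_lt (Finset.mem_insert_of_mem hx) fun u hu hux => ?_
    rcases Finset.mem_insert.1 hu with rfl | hu
    · exact Finset.mem_insert_self _ _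
    · refine Finset.mem_insert_of_mem ((Finset.mem_union.1 hu).resolve_right fun hy => ?_)
      exact absurd (hXY x hx u hy).1 (not_lt.2 hux.le)
  have hYr : ∀ y ∈ Y, X.card + 1 ≤ ((insert z (X ∪ Y)).filter (· < y)).card := by
    intro y hy
    rw [← Finset.card_insert_of_notMem hzX']
    refine le_card_filter_lt (Finset.insert_subset_insert _ Finset.subset_union_left) ?_
    intro u hu
    rcases Finset.mem_insert.1 hu with rfl | hu
    · exact hzY y hy
    · exact (hXY u hu y hy).1
  refine isCopySet_of_rank
    (by rw [Finset.card_insert_of_notMem hz, Finset.card_union_of_disjoint hXY.disjoint, hc]) ?_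
  intro x hx y hy hxy i j hij hlt hi hj
  obtain ⟨h1, h2⟩ := hcross i j hij hlt
  rw [Finset.mem_insert, Finset.mem_union] at hx hy
  rcases hx with rfl | hx | hx
  · refine absurd ?_ (hiso i j hij)
    rw [← hi, Finset.card_eq_zero, Finset.filter_eq_empty_iff]
    intro u hu
    rw [Finset.mem_insert, Finset.mem_union] at hu
    rcases hu with rfl | hu | hu
    · exact lt_irrefl _
    · exact (hzX u hu).asymm
    · exact (hzY u hu).asymm
  · rcases hy with rfl | hy | hy
    · exact absurd hxy (hzX x hx).asymm
    · have := hXr y hy; omega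
    · exact (hXY x hx y hy).2
  · have := hYr x hx; omega

lemma isCopySet_insert_middle {X Y : Finset (Fin n)} {z : Fin n} (hXY : IsOrderedBiclique G X Y)
    (hzX : ∀ x ∈ X, x < z) (hzY : ∀ y ∈ Y, z < y)
    (hc : X.card + Y.card + 1 = h)
    (hcross : ∀ i j : Fin h, H.Adj i j → i < j → (i : ℕ) < X.card ∧ X.card < j) :
    IsCopySet H G (insert z (X ∪ Y)) := by
  have hz : z ∉ X ∪ Y := fun hz => (Finset.mem_union.1 hz).elim
    (fun hx => (hzX z hx).false) (fun hy => (hzY z hy).false)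
  have hzX' : z ∉ X := fun hx => hz (Finset.mem_union_left _ hx)
  have hXz : ∀ x ∈ insert z X, ((insert z (X ∪ Y)).filter (· < x)).card < X.card + 1 := by
    intro x hx
    rw [← Finset.card_insert_of_notMem hzX']
    refine card_filter_lt_lt hx fun u hu hux => ?_
    rw [Finset.mem_insert, Finset.mem_union] at hu
    rcases hu with rfl | hu | hu
    · exact Finset.mem_insert_self _ _
    · exact Finset.mem_insert_of_mem hu
    · rcases Finset.mem_insert.1 hx with rfl | hx
      · exact absurd (hzY u hu) hux.asymm
      · exact absurd (hXY x hx u hu).1 hux.asymm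
  have hYr : ∀ y ∈ insert z Y, X.card ≤ ((insert z (X ∪ Y)).filter (· < y)).card := by
    intro y hy
    refine le_card_filter_lt
      (Finset.subset_union_left.trans (Finset.subset_insert _ _)) fun u hu => ?_
    rcases Finset.mem_insert.1 hy with rfl | hy
    · exact hzX u hu
    · exact (hXY u hu y hy).1
  refine isCopySet_of_rank
    (by rw [Finset.card_insert_of_notMem hz, Finset.card_union_of_disjoint hXY.disjoint, hc]) ?_
  intro x hx y hy hxy i j hij hlt hi hj
  obtain ⟨h1, h2⟩ := hcross i j hij hlt
  have hx' : x ∈ X := by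
    by_contra hcon
    have := hYr x (by simp only [Finset.mem_insert, Finset.mem_union] at hx ⊢; tauto)
    omega
  have hy' : y ∈ Y := by
    by_contra hcon
    have := hXz y (by simp only [Finset.mem_insert, Finset.mem_union] at hy ⊢; tauto)
    omega
  exact (hXY x hx' y hy').2

lemma isCopySet_insert_last {X Y : Finset (Fin n)} {v : Fin n} (hYX : IsOrderedBiclique G Y X)
    (hvX : ∀ x ∈ X, x < v ∧ G.Adj x v) (hvY : ∀ y ∈ Y, y < v)
    (hc : Y.card + X.card + 1 = h)
    (hlast : ∀ i j : Fin h, H.Adj i j → i < j →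
      ((j : ℕ) + 1 = h → Y.card ≤ i) ∧ ((j : ℕ) + 1 < h → (i : ℕ) < Y.card ∧ Y.card ≤ j)) :
    IsCopySet H G (insert v (Y ∪ X)) := by
  have hv : v ∉ Y ∪ X := fun hv => (Finset.mem_union.1 hv).elim
    (fun hx => (hvY v hx).false) (fun hy => (hvX v hy).1.false)
  have hcard : (Y ∪ X).card = Y.card + X.card := Finset.card_union_of_disjoint hYX.disjoint
  have hYr : ∀ y ∈ Y, ((insert v (Y ∪ X)).filter (· < y)).card < Y.card := by
    intro y hy
    refine card_filter_lt_lt hy fun u hu huy => ?_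
    rw [Finset.mem_insert, Finset.mem_union] at hu
    rcases hu with rfl | hu | hu
    · exact absurd (hvY y hy) huy.asymm
    · exact hu
    · exact absurd (hYX y hy u hu).1 huy.asymm
  have hXr : ∀ x ∈ X, Y.card ≤ ((insert v (Y ∪ X)).filter (· < x)).card := fun x hx =>
    le_card_filter_lt (Finset.subset_union_left.trans (Finset.subset_insert _ _))
      fun u hu => (hYX u hu x hx).1
  have hvr : (Y ∪ X).card ≤ ((insert v (Y ∪ X)).filter (· < v)).card :=
    le_card_filter_lt (Finset.subset_insert _ _) fun u hu =>
      (Finset.mem_union.1 hu).elim (fun hu => hvY u hu) (fun hu => (hvX u hu).1)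
  have hltv : ∀ x ∈ Y ∪ X, ((insert v (Y ∪ X)).filter (· < x)).card < (Y ∪ X).card := by
    intro x hx
    refine card_filter_lt_lt hx fun u hu hux => ?_
    rcases Finset.mem_insert.1 hu with rfl | hu
    · exact absurd hux ((Finset.mem_union.1 hx).elim (fun hu => (hvY x hu).asymm)
        (fun hu => (hvX x hu).1.asymm))
    · exact hu
  refine isCopySet_of_rank (by rw [Finset.card_insert_of_notMem hv, hcard, hc]) ?_
  intro x hx y hy hxy i j hij hlt hi hj
  obtain ⟨h1, h2⟩ := hlast i j hij hlt
  have hjh := j.2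
  have hxv : x ∈ Y ∪ X := (Finset.mem_insert.1 hx).resolve_left fun hxv => by
    subst hxv
    omega
  rcases Finset.mem_insert.1 hy with rfl | hy
  · have := h1 (by omega)
    rcases Finset.mem_union.1 hxv with hx | hx
    · have := hYr x hx; omega
    · exact (hvX x hx).2
  · have hlt' := hltv y hy
    obtain ⟨h3, h4⟩ := h2 (by omega)
    rcases Finset.mem_union.1 hxv with hx | hx
    · rcases Finset.mem_union.1 hy with hy | hy
      · have := hYr y hy; omega
      · exact (hYX x hx y hy).2
    · have := hXr x hx; omega

lemma hasPerfectTilingOn_empty : HasPerfectTilingOn H G ∅ :=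
  ⟨∅, by simp, by simp, by simp⟩

lemma IsCopySet.hasPerfectTilingOn {S : Finset (Fin n)} (hS : IsCopySet H G S) :
    HasPerfectTilingOn H G S :=
  ⟨{S}, by simpa using hS, by simp, by simp⟩

lemma HasPerfectTilingOn.union {S T : Finset (Fin n)} (hS : HasPerfectTilingOn H G S)
    (hT : HasPerfectTilingOn H G T) (hST : Disjoint S T) : HasPerfectTilingOn H G (S ∪ T) := by
  obtain ⟨A, hA1, hA2, rfl⟩ := hS
  obtain ⟨B, hB1, hB2, rfl⟩ := hT
  refine ⟨A ∪ B, ?_, ?_, ?_⟩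
  · intro X hX
    exact (Finset.mem_union.1 hX).elim (hA1 X) (hB1 X)
  · rw [Finset.coe_union, Set.pairwiseDisjoint_union]
    refine ⟨hA2, hB2, fun X hX Y hY _ => ?_⟩
    exact hST.mono (Finset.subset_biUnion_of_mem id hX) (Finset.subset_biUnion_of_mem id hY)
  · exact Finset.union_biUnion

lemma hasPerfectTilingOn_of_label {ι : Type*} [Fintype ι] [DecidableEq ι] {S : Finset (Fin n)}
    (f : Fin n → ι) (hf : ∀ i, IsCopySet H G (S.filter fun v => f v = i)) :
    HasPerfectTilingOn H G S := by
  refine ⟨Finset.univ.image fun i => S.filter fun v => f v = i, ?_, ?_, ?_⟩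
  · intro T hT
    obtain ⟨i, -, rfl⟩ := Finset.mem_image.1 hT
    exact hf i
  · intro A hA B hB hAB
    simp only [Finset.coe_image, Finset.coe_univ, Set.image_univ, Set.mem_range] at hA hB
    obtain ⟨i, rfl⟩ := hA
    obtain ⟨j, rfl⟩ := hB
    have hij : i ≠ j := fun hij => hAB (by rw [hij])
    refine Finset.disjoint_left.2 fun v hv hw => hij ?_
    simp only [id, Finset.mem_filter] at hv hw
    rw [← hv.2, hw.2]
  · ext v
    simp

lemma exists_label {α ι : Type*} [DecidableEq α] [Fintype ι] [DecidableEq ι] [Nonempty ι]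
    (X : Finset α) (x : ι → ℕ) (hx : X.card = ∑ i, x i) :
    ∃ f : α → ι, ∀ i, (X.filter fun a => f a = i).card = x i := by
  have e : X ≃ (Σ i, Fin (x i)) := Fintype.equivOfCardEq (by simp [hx])
  refine ⟨fun a => if ha : a ∈ X then (e ⟨a, ha⟩).1 else Classical.arbitrary ι, fun i => ?_⟩
  have : (X.filter fun a => (if ha : a ∈ X then (e ⟨a, ha⟩).1 else Classical.arbitrary ι) = i) =
      (Finset.univ : Finset (Fin (x i))).map ((Function.Embedding.sigmaMk i).trans
        (e.symm.toEmbedding.trans (Function.Embedding.subtype _))) := by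
    ext a
    simp only [Finset.mem_filter, Finset.mem_map, Finset.mem_univ, true_and]
    constructor
    · rintro ⟨ha, hi⟩
      rw [dif_pos ha] at hi
      subst hi
      exact ⟨(e ⟨a, ha⟩).2, by simp⟩
    · rintro ⟨t, rfl⟩
      exact ⟨(e.symm ⟨i, t⟩).2, by simp⟩
  rw [this]
  simp

end Tilings

section Blocks

variable {h n : ℕ} {H : SimpleGraph (Fin h)} {G : SimpleGraph (Fin n)}

/-- The structural consequences of Property A, the failure of Property B witnessed by an isolated
first vertex, and the failure of Property C at the last vertex. -/
structure HasIsolatedFirst (H : SimpleGraph (Fin h)) : Prop where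
  middle : ∀ i j : Fin h, H.Adj i j → i < j → (i : ℕ) + 2 ≤ (h + 1) / 2 ∧ h / 2 + 1 ≤ j
  first : ∀ i j : Fin h, H.Adj i j → (i : ℕ) ≠ 0
  last : ∃ s < h, ∀ i j : Fin h, H.Adj i j → i < j →
    ((j : ℕ) + 1 = h → s ≤ i) ∧ ((j : ℕ) + 1 < h → (i : ℕ) < s ∧ s ≤ j)

lemma two_mul_sum_div_two (a m : ℕ) (hm : Even m ∨ Even a) :
    2 * ∑ i : Fin m, (a + (i : ℕ) % 2) / 2 = m * a := by
  rw [Fin.sum_univ_eq_sum_range fun i => (a + i % 2) / 2]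
  by_cases ha : Even a
  · obtain ⟨b, rfl⟩ := ha
    have : ∀ i ∈ Finset.range m, (b + b + i % 2) / 2 = b := fun i _ => by omega
    rw [Finset.sum_congr rfl this]
    simp
    ring
  · obtain ⟨b, rfl⟩ := Nat.not_even_iff_odd.1 ha
    obtain ⟨c, rfl⟩ := hm.resolve_right ha
    clear hm ha
    induction c with
    | zero => simp
    | succ c ih =>
      have e : c + 1 + (c + 1) = (c + c) + 1 + 1 := by ring
      rw [e, Finset.sum_range_succ, Finset.sum_range_succ]
      have h1 : (2 * b + 1 + (c + c) % 2) / 2 = b := by omega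
      have h2 : (2 * b + 1 + (c + c + 1) % 2) / 2 = b + 1 := by omega
      rw [h1, h2]
      linarith

lemma two_mul_sum_sub_div_two (a m : ℕ) (hm : Even m ∨ Even a) (ha : 1 ≤ a) :
    2 * ∑ i : Fin m, (a - (a + (i : ℕ) % 2) / 2) = m * a := by
  have h1 := two_mul_sum_div_two a m hm
  have h2 : ∑ i : Fin m, (a - (a + (i : ℕ) % 2) / 2) + ∑ i : Fin m, (a + (i : ℕ) % 2) / 2 =
      m * a := by
    rw [← Finset.sum_add_distrib, Finset.sum_congr (g := fun _ => a) rfl fun (i : Fin m) _ =>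
      Nat.sub_add_cancel (show (a + (i : ℕ) % 2) / 2 ≤ a by omega)]
    simp
  omega

/-- A set that has a perfect tiling, also after adding any `h` further vertices of `I`. -/
def IsBlock (H : SimpleGraph (Fin h)) (G : SimpleGraph (Fin n)) (I B : Finset (Fin n)) : Prop :=
  HasPerfectTilingOn H G B ∧
    ∀ Q ⊆ I, Q.card = h → Disjoint B Q → HasPerfectTilingOn H G (B ∪ Q)

lemma filter_union_ite {α ι : Type*} [DecidableEq α] [DecidableEq ι] {X Y : Finset α}
    (hXY : Disjoint X Y) (f g : α → ι) (i : ι) :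
    (X ∪ Y).filter (fun v => (if v ∈ X then f v else g v) = i) =
      X.filter (fun v => f v = i) ∪ Y.filter (fun v => g v = i) := by
  ext v
  have : v ∈ X → v ∉ Y := fun hx => Finset.disjoint_left.1 hXY hx
  simp only [Finset.mem_filter, Finset.mem_union]
  split_ifs <;> tauto

lemma HasIsolatedFirst.hasPerfectTilingOn_biclique (hH : HasIsolatedFirst H) (h2 : 2 ≤ h)
    {X Y : Finset (Fin n)} (hXY : IsOrderedBiclique G X Y)
    (hX : 2 * X.card = h * (h - 1)) (hY : 2 * Y.card = h * (h - 1)) :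
    HasPerfectTilingOn H G (X ∪ Y) := by
  have hpar : Even (h - 1) ∨ Even h := by
    rcases Nat.even_or_odd h with he | he
    · exact Or.inr he
    · exact Or.inl (Nat.Odd.sub_odd he odd_one)
  have : Nonempty (Fin (h - 1)) := ⟨⟨0, by omega⟩⟩
  obtain ⟨f, hf⟩ := exists_label X (fun i : Fin (h - 1) => (h + (i : ℕ) % 2) / 2) (by
    have := two_mul_sum_div_two h (h - 1) hpar
    rw [mul_comm (h - 1)] at this
    omega)
  obtain ⟨g, hg⟩ := exists_label Y (fun i : Fin (h - 1) => h - (h + (i : ℕ) % 2) / 2) (by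
    have := two_mul_sum_sub_div_two h (h - 1) hpar (by omega)
    rw [mul_comm (h - 1)] at this
    omega)
  refine hasPerfectTilingOn_of_label (fun v => if v ∈ X then f v else g v) fun i => ?_
  rw [filter_union_ite hXY.disjoint]
  refine isCopySet_union_s9 (hXY.mono (Finset.filter_subset _ _) (Finset.filter_subset _ _))
    (by rw [hf, hg]; omega) fun a b hab hlt => ?_
  have := hH.middle a b hab hlt
  rw [hf]
  omega

lemma HasIsolatedFirst.isBlock_biclique (hH : HasIsolatedFirst H) (h2 : 2 ≤ h)
    {X Y I : Finset (Fin n)} (hXY : IsOrderedBiclique G X Y)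
    (hX : 2 * X.card = h * (h - 1)) (hY : 2 * Y.card = h * (h - 1))
    (hI : (∀ z ∈ I, (∀ x ∈ X, z < x) ∧ ∀ y ∈ Y, z < y) ∨
      (∀ z ∈ I, (∀ x ∈ X, x < z) ∧ ∀ y ∈ Y, z < y)) :
    IsBlock H G I (X ∪ Y) := by
  refine ⟨hH.hasPerfectTilingOn_biclique h2 hXY hX hY, fun Q hQI hQ hdisj => ?_⟩
  have hpar : Even h ∨ Even (h - 1) := by
    rcases Nat.even_or_odd h with he | he
    · exact Or.inl he
    · exact Or.inr (Nat.Odd.sub_odd he odd_one)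
  have : Nonempty (Fin h) := ⟨⟨0, by omega⟩⟩
  obtain ⟨f, hf⟩ := exists_label X (fun i : Fin h => (h - 1 + (i : ℕ) % 2) / 2) (by
    have := two_mul_sum_div_two (h - 1) h hpar
    omega)
  obtain ⟨g, hg⟩ := exists_label Y (fun i : Fin h => h - 1 - (h - 1 + (i : ℕ) % 2) / 2) (by
    have := two_mul_sum_sub_div_two (h - 1) h hpar (by omega)
    omega)
  obtain ⟨e, he⟩ := exists_label Q (fun i : Fin h => 1) (by simp [hQ])
  refine hasPerfectTilingOn_of_label
    (fun v => if v ∈ X ∪ Y then (if v ∈ X then f v else g v) else e v) fun i => ?_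
  rw [filter_union_ite hdisj, filter_union_ite hXY.disjoint]
  obtain ⟨z, hz⟩ := Finset.card_eq_one.1 (he i)
  have hzI : z ∈ I := hQI (Finset.mem_filter.1 (hz.symm ▸ Finset.mem_singleton_self z)).1
  rw [hz, Finset.union_comm, ← Finset.insert_eq]
  have hmono := hXY.mono (Finset.filter_subset (fun v => f v = i) X)
    (Finset.filter_subset (fun v => g v = i) Y)
  have hc : (X.filter fun v => f v = i).card + (Y.filter fun v => g v = i).card + 1 = h := by
    rw [hf, hg]; omega
  rcases hI with hI | hI
  · refine isCopySet_insert_first hmono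
      (fun x hx => (hI z hzI).1 x (Finset.mem_filter.1 hx).1)
      (fun y hy => (hI z hzI).2 y (Finset.mem_filter.1 hy).1) hc hH.first fun a b hab hlt => ?_
    have := hH.middle a b hab hlt
    rw [hf]
    omega
  · refine isCopySet_insert_middle hmono
      (fun x hx => (hI z hzI).1 x (Finset.mem_filter.1 hx).1)
      (fun y hy => (hI z hzI).2 y (Finset.mem_filter.1 hy).1) hc fun a b hab hlt => ?_
    have := hH.middle a b hab hlt
    rw [hf]
    omega

/-- Greedily chosen disjoint blocks absorb every not too large set of vertices of `I` whose size
is divisible by `h`. -/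
lemma exists_absorber_of_blocks {I : Finset (Fin n)} {s u : ℕ}
    (hB : ∀ U : Finset (Fin n), U.card ≤ u →
      ∃ B, IsBlock H G I B ∧ B.card ≤ s ∧ Disjoint B U) (m : ℕ) :
    ∀ U : Finset (Fin n), U.card + m * s ≤ u → ∃ S : Finset (Fin n), Disjoint S U ∧
      S.card ≤ m * s ∧ ∀ j ≤ m, ∀ Q ⊆ I, Q.card = h * j → Disjoint S Q →
        HasPerfectTilingOn H G (S ∪ Q) := by
  induction m with
  | zero =>
    intro U _
    refine ⟨∅, by simp, by simp, fun j hj Q _ hQ _ => ?_⟩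
    obtain rfl : Q = ∅ := by simpa [Nat.le_zero.1 hj] using hQ
    simpa using hasPerfectTilingOn_empty
  | succ m ih =>
    intro U hU
    rw [Nat.succ_mul] at hU
    obtain ⟨S, hSU, hSc, hS⟩ := ih U (by omega)
    obtain ⟨B, hB, hBc, hBU⟩ := hB (U ∪ S) ((Finset.card_union_le _ _).trans (by omega))
    rw [Finset.disjoint_union_right] at hBU
    refine ⟨S ∪ B, Finset.disjoint_union_left.2 ⟨hSU, hBU.1⟩,
      (Finset.card_union_le _ _).trans (by rw [Nat.succ_mul]; omega), fun j hj Q hQI hQ hdisj => ?_⟩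
    rw [Finset.disjoint_union_left] at hdisj
    rcases Nat.lt_or_ge m j with hmj | hmj
    · obtain rfl : j = m + 1 := by omega
      obtain ⟨P, hPQ, hP⟩ := Finset.exists_subset_card_eq (s := Q) (n := h)
        (by rw [hQ]; exact Nat.le_mul_of_pos_right h (by omega))
      have h1 := hB.2 P (hPQ.trans hQI) hP (hdisj.2.mono_right hPQ)
      have h2 := hS m le_rfl (Q \ P) (Finset.sdiff_subset.trans hQI)
        (by rw [Finset.card_sdiff_of_subset hPQ, hQ, hP, Nat.mul_succ]; omega)
        (hdisj.1.mono_right Finset.sdiff_subset)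
      have h3 := h2.union h1 (by
        rw [Finset.disjoint_union_left, Finset.disjoint_union_right, Finset.disjoint_union_right]
        exact ⟨⟨hBU.2.symm, hdisj.1.mono_right hPQ⟩,
          hdisj.2.symm.mono_left Finset.sdiff_subset, Finset.sdiff_disjoint⟩)
      convert h3 using 1
      rw [Finset.union_union_union_comm, Finset.sdiff_union_of_subset hPQ]
    · have h3 := (hS j hmj Q hQI hQ hdisj.1).union hB.1
        (Finset.disjoint_union_left.2 ⟨hBU.2.symm, hdisj.2.symm⟩)
      rwa [Finset.union_right_comm] at h3

end Blocks

section Density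

variable {h n : ℕ} {H : SimpleGraph (Fin h)} {G : SimpleGraph (Fin n)}

open scoped Classical in
/-- A pair of vertex sets in which every vertex of the first set has linearly many neighbours in
the second contains a complete bipartite graph of any prescribed constant size. -/
lemma exists_complete_pair {δ : ℝ} (hδ : 0 < δ) (t : ℕ) :
    ∃ M : ℕ, ∀ {n : ℕ} (G : SimpleGraph (Fin n)) (A B : Finset (Fin n)) (N : ℕ),
      M ≤ A.card → M ≤ N → B.card ≤ N →
      (∀ a ∈ A, δ * N ≤ ((B.filter (G.Adj a)).card : ℝ)) →
      ∃ X ⊆ A, ∃ Y ⊆ B, X.card = t ∧ Y.card = t ∧ ∀ x ∈ X, ∀ y ∈ Y, G.Adj x y := by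
  set K : ℕ := ⌈2 * t / δ⌉₊ + 1 with hK
  have hKδ : 2 * t ≤ K * δ := by
    have : (2 * t / δ : ℝ) ≤ K := (Nat.le_ceil _).trans (by rw [hK]; push_cast; linarith)
    rwa [div_le_iff₀ hδ] at this
  have hK0 : (0 : ℝ) < K := by rw [hK]; positivity
  refine ⟨max K ⌈2 * (2 ^ K * t) / δ⌉₊, fun G A B N hA hN hB hdeg => ?_⟩
  obtain ⟨A', hA', hA'c⟩ := Finset.exists_subset_card_eq ((le_max_left _ _).trans hA)
  have hNδ : 2 * (2 ^ K * t) ≤ N * δ := by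
    have : (2 * (2 ^ K * t) / δ : ℝ) ≤ N :=
      (Nat.le_ceil _).trans (by exact_mod_cast (le_max_right _ _).trans hN)
    rwa [div_le_iff₀ hδ] at this
  set B₁ := B.filter fun b => t ≤ (A'.filter fun a => G.Adj a b).card with hB₁
  have hcount : K * (δ * N) ≤ N * t + B₁.card * K := by
    have h1 : (K : ℝ) * (δ * N) ≤ ∑ a ∈ A', ((B.filter (G.Adj a)).card : ℝ) := by
      have := Finset.card_nsmul_le_sum A' (fun a => ((B.filter (G.Adj a)).card : ℝ)) (δ * N)
        fun a ha => hdeg a (hA' ha)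
      rwa [hA'c, nsmul_eq_mul] at this
    have h2 : ∑ a ∈ A', (B.filter (G.Adj a)).card =
        ∑ b ∈ B, (A'.filter fun a => G.Adj a b).card :=
      Finset.sum_card_bipartiteAbove_eq_sum_card_bipartiteBelow _
    have h3 : ∑ b ∈ B, (A'.filter fun a => G.Adj a b).card ≤ N * t + B₁.card * K := by
      calc ∑ b ∈ B, (A'.filter fun a => G.Adj a b).card
          ≤ ∑ b ∈ B, (t + if t ≤ (A'.filter fun a => G.Adj a b).card then K else 0) := by
            refine Finset.sum_le_sum fun b _ => ?_
            have : (A'.filter fun a => G.Adj a b).card ≤ K :=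
              hA'c ▸ Finset.card_filter_le _ _
            split_ifs <;> omega
        _ = B.card * t + B₁.card * K := by
            rw [Finset.sum_add_distrib, ← Finset.sum_filter]
            simp [hB₁]
        _ ≤ _ := by gcongr
    calc (K : ℝ) * (δ * N) ≤ _ := h1
      _ = ((∑ a ∈ A', (B.filter (G.Adj a)).card : ℕ) : ℝ) := by push_cast; rfl
      _ ≤ ((N * t + B₁.card * K : ℕ) : ℝ) := by rw [h2]; exact_mod_cast h3
      _ = _ := by push_cast; rfl
  have hB₁c : 2 ^ K * t ≤ B₁.card := by
    have h1 : (2 * t : ℝ) * N ≤ K * δ * N := by gcongr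
    have h2 : (K : ℝ) * (N * δ) ≤ K * (2 * B₁.card) := by nlinarith
    have h3 := le_of_mul_le_mul_left h2 hK0
    have h4 : ((2 ^ K * t : ℕ) : ℝ) ≤ B₁.card := by push_cast; linarith
    exact_mod_cast h4
  obtain ⟨X, hX, hXc⟩ := Finset.exists_le_card_fiber_of_mul_le_card_of_maps_to
    (s := B₁) (t := A'.powerset) (f := fun b => A'.filter fun a => G.Adj a b) (n := t)
    (fun b _ => by simp) ⟨∅, by simp⟩ (by simpa [hA'c] using hB₁c)
  rcases Nat.eq_zero_or_pos t with rfl | ht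
  · exact ⟨∅, by simp, ∅, by simp, by simp⟩
  have hXt : t ≤ X.card := by
    obtain ⟨b, hb⟩ := Finset.card_pos.1 (ht.trans_le hXc)
    obtain ⟨hb1, rfl⟩ := Finset.mem_filter.1 hb
    exact (Finset.mem_filter.1 hb1).2
  obtain ⟨X', hX', hX'c⟩ := Finset.exists_subset_card_eq hXt
  obtain ⟨Y, hY, hYc⟩ := Finset.exists_subset_card_eq hXc
  refine ⟨X', (hX'.trans (Finset.mem_powerset.1 hX)).trans hA', Y, fun y hy =>
    (Finset.mem_filter.1 (Finset.mem_filter.1 (hY hy)).1).1, hX'c, hYc, fun x hx y hy => ?_⟩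
  have hxX := hX' hx
  rw [← (Finset.mem_filter.1 (hY hy)).2] at hxX
  exact (Finset.mem_filter.1 hxX).2

lemma exists_halves {t : ℕ} (ht : 0 < t) {X : Finset (Fin n)} (hX : X.card = t + t) :
    ∃ m, ∃ X₁ ⊆ X, ∃ X₂ ⊆ X, X₁.card = t ∧ X₂.card = t ∧
      (∀ x ∈ X₁, x ≤ m) ∧ ∀ x ∈ X₂, m < x := by
  refine ⟨X.orderEmbOfFin hX (Fin.castAdd t ⟨t - 1, by omega⟩),
    Finset.univ.map ((Fin.castAddEmb t).trans (X.orderEmbOfFin hX).toEmbedding), ?_,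
    Finset.univ.map ((Fin.natAddEmb t).trans (X.orderEmbOfFin hX).toEmbedding), ?_,
    by simp, by simp, ?_, ?_⟩
  · intro x hx
    obtain ⟨i, -, rfl⟩ := Finset.mem_map.1 hx
    exact X.orderEmbOfFin_mem hX _
  · intro x hx
    obtain ⟨i, -, rfl⟩ := Finset.mem_map.1 hx
    exact X.orderEmbOfFin_mem hX _
  · intro x hx
    obtain ⟨i, -, rfl⟩ := Finset.mem_map.1 hx
    refine (X.orderEmbOfFin hX).monotone ?_
    simp only [Fin.le_def, Fin.castAddEmb_apply, Fin.val_castAdd]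
    omega
  · intro x hx
    obtain ⟨i, -, rfl⟩ := Finset.mem_map.1 hx
    refine (X.orderEmbOfFin hX).strictMono ?_
    simp only [Fin.lt_def, Fin.natAddEmb_apply, Fin.val_castAdd, Fin.val_natAdd]
    omega

open scoped Classical in
lemma exists_orderedBiclique {δ : ℝ} (hδ : 0 < δ) {t : ℕ} (ht : 0 < t) :
    ∃ M : ℕ, ∀ {n : ℕ} (G : SimpleGraph (Fin n)) (A B : Finset (Fin n)) (N : ℕ),
      M ≤ A.card → M ≤ N → B.card ≤ N →
      (∀ a ∈ A, δ * N ≤ ((B.filter (G.Adj a)).card : ℝ)) →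
      ∃ X ⊆ A, ∃ Y ⊆ B, X.card = t ∧ Y.card = t ∧
        (IsOrderedBiclique G X Y ∨ IsOrderedBiclique G Y X) := by
  obtain ⟨M, hM⟩ := exists_complete_pair hδ (t + t)
  refine ⟨M, fun G A B N hA hN hB hdeg => ?_⟩
  obtain ⟨X, hXA, Y, hYB, hX, hY, hXY⟩ := hM G A B N hA hN hB hdeg
  obtain ⟨p, X₁, hX₁, X₂, hX₂, c1, c2, l1, l2⟩ := exists_halves ht hX
  obtain ⟨q, Y₁, hY₁, Y₂, hY₂, d1, d2, m1, m2⟩ := exists_halves ht hY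
  rcases le_or_gt p q with hpq | hpq
  · exact ⟨X₁, hX₁.trans hXA, Y₂, hY₂.trans hYB, c1, d2, Or.inl fun x hx y hy =>
      ⟨((l1 x hx).trans hpq).trans_lt (m2 y hy), hXY x (hX₁ hx) y (hY₂ hy)⟩⟩
  · exact ⟨X₂, hX₂.trans hXA, Y₁, hY₁.trans hYB, c2, d1, Or.inr fun y hy x hx =>
      ⟨((m1 y hy).trans_lt hpq).trans (l2 x hx), (hXY x (hX₂ hx) y (hY₁ hy)).symm⟩⟩

open scoped Classical in
/-- A vertex lying after a set `Z` of large minimum degree, with many neighbours in `Z`, is the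
last vertex of a copy of `H` whose other vertices lie in `Z`. -/
lemma HasIsolatedFirst.exists_copy_last (hH : HasIsolatedFirst H) (h2 : 2 ≤ h) {θ : ℝ}
    (hθ : 0 < θ) :
    ∃ M : ℕ, ∀ {n : ℕ} (G : SimpleGraph (Fin n)) (Z : Finset (Fin n)) (N : ℕ) (v : Fin n),
      M ≤ N → Z.card ≤ N → (∀ z ∈ Z, z < v) →
      (∀ u ∈ insert v Z, θ * N ≤ ((Z.filter (G.Adj u)).card : ℝ)) →
      ∃ T ⊆ Z, T.card = h - 1 ∧ IsCopySet H G (insert v T) := by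
  obtain ⟨M, hM⟩ := exists_orderedBiclique hθ (t := h) (by omega)
  refine ⟨max M ⌈M / θ⌉₊, fun G Z N v hN hZ hv hdeg => ?_⟩
  have hA : M ≤ (Z.filter (G.Adj v)).card := by
    have h1 : (M / θ : ℝ) ≤ N :=
      (Nat.le_ceil _).trans (by exact_mod_cast (le_max_right _ _).trans hN)
    rw [div_le_iff₀ hθ, mul_comm] at h1
    exact_mod_cast h1.trans (hdeg v (Finset.mem_insert_self _ _))
  obtain ⟨X, hX, Y, hY, hXc, hYc, hXY⟩ := hM G (Z.filter (G.Adj v)) Z N hA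
    ((le_max_left _ _).trans hN) hZ fun a ha =>
      hdeg a (Finset.mem_insert_of_mem (Finset.filter_subset _ _ ha))
  rcases hXY with hXY | hYX
  · obtain ⟨X', hX', hX'c⟩ := Finset.exists_subset_card_eq (s := X) (n := h / 2) (by omega)
    obtain ⟨Y', hY', hY'c⟩ := Finset.exists_subset_card_eq (s := Y) (n := h - 1 - h / 2) (by omega)
    have hv' : v ∉ Y' := fun hvY => (hv v (hY (hY' hvY))).false
    refine ⟨X' ∪ Y', Finset.union_subset ((hX'.trans hX).trans (Finset.filter_subset _ _))
      (hY'.trans hY), ?_, ?_⟩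
    · rw [Finset.card_union_of_disjoint (hXY.mono hX' hY').disjoint]
      omega
    · rw [← Finset.union_insert]
      refine isCopySet_union_s9 (fun x hx y hy => ?_) ?_ fun i j hij hlt => ?_
      · rcases Finset.mem_insert.1 hy with rfl | hy
        · have := Finset.mem_filter.1 (hX (hX' hx))
          exact ⟨hv x this.1, this.2.symm⟩
        · exact hXY x (hX' hx) y (hY' hy)
      · rw [Finset.card_insert_of_notMem hv']
        omega
      · have := hH.middle i j hij hlt
        omega
  · obtain ⟨s, hs, hlast⟩ := hH.last
    obtain ⟨Y', hY', hY'c⟩ := Finset.exists_subset_card_eq (s := Y) (n := s) (by omega)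
    obtain ⟨X', hX', hX'c⟩ := Finset.exists_subset_card_eq (s := X) (n := h - 1 - s) (by omega)
    refine ⟨Y' ∪ X', Finset.union_subset (hY'.trans hY)
      ((hX'.trans hX).trans (Finset.filter_subset _ _)), ?_, ?_⟩
    · rw [Finset.card_union_of_disjoint (hYX.mono hY' hX').disjoint]
      omega
    · refine isCopySet_insert_last (hYX.mono hY' hX') (fun x hx => ?_)
        (fun y hy => hv y (hY (hY' hy))) (by omega) (by rw [hY'c]; exact hlast)
      have := Finset.mem_filter.1 (hX (hX' hx))
      exact ⟨hv x this.1, this.2.symm⟩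

/-- Greedily covering a set `R` of vertices by disjoint copies of `H` that otherwise use `Z`. -/
lemma exists_cover {Z R : Finset (Fin n)} (hZR : Disjoint Z R) {L : ℕ}
    (hcov : ∀ U : Finset (Fin n), U.card ≤ L → ∀ v ∈ R,
      ∃ T ⊆ Z \ U, T.card = h - 1 ∧ IsCopySet H G (insert v T))
    (hL : (h - 1) * R.card ≤ L) :
    ∃ T ⊆ Z, T.card = (h - 1) * R.card ∧ HasPerfectTilingOn H G (T ∪ R) := by
  induction R using Finset.induction_on with
  | empty => exact ⟨∅, by simp, by simp, by simpa using hasPerfectTilingOn_empty⟩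
  | insert v R hvR ih =>
    rw [Finset.card_insert_of_notMem hvR, Nat.mul_succ] at hL ⊢
    rw [Finset.disjoint_insert_right] at hZR
    obtain ⟨T, hTZ, hTc, hT⟩ := ih hZR.2
      (fun U hU w hw => hcov U hU w (Finset.mem_insert_of_mem hw)) (by omega)
    obtain ⟨T', hT', hT'c, hT'v⟩ := hcov T (by omega) v (Finset.mem_insert_self _ _)
    have hTT' : Disjoint T T' := Finset.disjoint_left.2 fun x hx hx' =>
      (Finset.mem_sdiff.1 (hT' hx')).2 hx
    have hT'Z : T' ⊆ Z := hT'.trans Finset.sdiff_subset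
    refine ⟨T ∪ T', Finset.union_subset hTZ hT'Z,
      by rw [Finset.card_union_of_disjoint hTT', hTc, hT'c], ?_⟩
    have := hT.union hT'v.hasPerfectTilingOn (by
      rw [Finset.disjoint_insert_right, Finset.disjoint_union_left]
      exact ⟨fun hv => (Finset.mem_union.1 hv).elim (fun hv => hZR.1 (hTZ hv)) hvR, hTT',
        (hZR.2.mono_left hT'Z).symm⟩)
    convert this using 1
    ext x
    simp only [Finset.mem_union, Finset.mem_insert]
    tauto

end Density

section Sampling

variable {n : ℕ}

lemma exists_sample_weight {J : Type*} [Fintype J] [Nonempty J] {A : Finset (Fin n)}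
    {F : J → Finset (Fin n)} (hF : ∀ j, F j ⊆ A) {δ : ℝ} (hδ : 0 < δ)
    (hcard : ∀ j, δ * n ≤ ((F j).card : ℝ)) (i : ℕ) (hi : (i : ℝ) ≤ δ * n / 2) :
    ∃ Z ⊆ A, Z.card = i ∧
      ∑ j, (1 / 2 : ℝ) ^ (F j ∩ Z).card ≤ Fintype.card J * (1 - δ / 4) ^ i := by
  induction i with
  | zero => exact ⟨∅, by simp, by simp, by simp⟩
  | succ i ih =>
    push_cast at hi
    obtain ⟨Z, hZA, hZc, hZ⟩ := ih (by linarith)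
    have hn : (0 : ℝ) < n := by
      by_contra hn
      have : (0 : ℝ) ≤ i := Nat.cast_nonneg i
      nlinarith
    have hδ1 : δ ≤ 1 := by
      have h1 := hcard (Classical.arbitrary J)
      have h2 : ((F (Classical.arbitrary J)).card : ℝ) ≤ n := by
        exact_mod_cast (Finset.card_le_univ _).trans_eq (Fintype.card_fin n)
      nlinarith
    set Φ := ∑ j, (1 / 2 : ℝ) ^ (F j ∩ Z).card with hΦ
    have hΦ0 : 0 ≤ Φ := Finset.sum_nonneg fun j _ => by positivity
    have hsd : ∀ j, δ * n / 2 < ((F j \ Z).card : ℝ) := by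
      intro j
      have h1 : ((F j).card : ℝ) ≤ ((F j \ Z).card : ℝ) + Z.card := by
        exact_mod_cast Finset.card_le_card_sdiff_add_card
      have := hcard j
      rw [hZc] at h1
      linarith
    have hne : (A \ Z).Nonempty := by
      have h1 := hsd (Classical.arbitrary J)
      have h2 : 0 < (F (Classical.arbitrary J) \ Z).card := by
        have : (0 : ℝ) < (F (Classical.arbitrary J) \ Z).card := lt_trans (by positivity) h1
        exact_mod_cast this
      exact (Finset.card_pos.1 h2).mono (Finset.sdiff_subset_sdiff (hF _) le_rfl)
    obtain ⟨a, ha, haΦ⟩ : ∃ a ∈ A \ Z, δ / 2 * Φ ≤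
        ∑ j, if a ∈ F j then (1 / 2 : ℝ) ^ (F j ∩ Z).card else 0 := by
      refine Finset.exists_le_of_sum_le hne ?_
      rw [Finset.sum_comm, Finset.sum_const, nsmul_eq_mul]
      have hle : ((A \ Z).card : ℝ) ≤ n := by
        exact_mod_cast (Finset.card_le_univ _).trans_eq (Fintype.card_fin n)
      calc ((A \ Z).card : ℝ) * (δ / 2 * Φ) ≤ n * (δ / 2 * Φ) := by gcongr
        _ = ∑ j, δ * n / 2 * (1 / 2 : ℝ) ^ (F j ∩ Z).card := by
          rw [← Finset.mul_sum]; ring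
        _ ≤ _ := by
          refine Finset.sum_le_sum fun j _ => ?_
          rw [← Finset.sum_filter, Finset.sum_const, nsmul_eq_mul]
          refine mul_le_mul_of_nonneg_right ((hsd j).le.trans ?_) (by positivity)
          refine Nat.cast_le.2 (Finset.card_le_card fun x hx => ?_)
          rw [Finset.mem_sdiff] at hx
          simp only [Finset.mem_filter, Finset.mem_sdiff]
          exact ⟨⟨hF j hx.1, hx.2⟩, hx.1⟩
    rw [Finset.mem_sdiff] at ha
    refine ⟨insert a Z, Finset.insert_subset ha.1 hZA,
      by rw [Finset.card_insert_of_notMem ha.2, hZc], ?_⟩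
    have hstep : ∀ j, (1 / 2 : ℝ) ^ (F j ∩ insert a Z).card = (1 / 2 : ℝ) ^ (F j ∩ Z).card -
        1 / 2 * (if a ∈ F j then (1 / 2 : ℝ) ^ (F j ∩ Z).card else 0) := by
      intro j
      split_ifs with haj
      · rw [Finset.inter_insert_of_mem haj, Finset.card_insert_of_notMem (by simp [ha.2]),
          pow_succ]
        ring
      · rw [Finset.inter_insert_of_notMem haj]
        ring
    rw [Finset.sum_congr rfl fun j _ => hstep j, Finset.sum_sub_distrib, ← Finset.mul_sum,
      pow_succ, ← mul_assoc]
    calc _ ≤ Φ * (1 - δ / 4) := by linarith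
      _ ≤ _ := by gcongr; linarith

/-- A set of prescribed size meeting every member of a not too large family of linear-sized sets
proportionally. -/
lemma exists_sample {J : Type*} [Fintype J] [Nonempty J] {A : Finset (Fin n)}
    {F : J → Finset (Fin n)} (hF : ∀ j, F j ⊆ A) {δ : ℝ} (hδ : 0 < δ) (hδ1 : δ ≤ 1)
    (hcard : ∀ j, δ * n ≤ ((F j).card : ℝ)) (N : ℕ) (hN : (N : ℝ) ≤ δ * n / 2)
    (hJ : Real.log (Fintype.card J) ≤ δ * N / 8) :
    ∃ Z ⊆ A, Z.card = N ∧ ∀ j, δ / 8 * N ≤ ((F j ∩ Z).card : ℝ) := by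
  obtain ⟨Z, hZA, hZc, hZ⟩ := exists_sample_weight hF hδ hcard N hN
  refine ⟨Z, hZA, hZc, fun j => ?_⟩
  have h1 : (1 / 2 : ℝ) ^ (F j ∩ Z).card ≤ ∑ j, (1 / 2 : ℝ) ^ (F j ∩ Z).card :=
    Finset.single_le_sum (f := fun j => (1 / 2 : ℝ) ^ (F j ∩ Z).card)
      (fun j _ => by positivity) (Finset.mem_univ j)
  have h2 : (1 - δ / 4) ^ N ≤ Real.exp (-(δ / 4 * N)) := by
    have : 1 - δ / 4 ≤ Real.exp (-(δ / 4)) := by linarith [Real.add_one_le_exp (-(δ / 4))]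
    calc (1 - δ / 4) ^ N ≤ Real.exp (-(δ / 4)) ^ N := pow_le_pow_left₀ (by linarith) this N
      _ = _ := by rw [← Real.exp_nat_mul]; ring_nf
  have h3 : Real.exp (-((F j ∩ Z).card : ℝ)) ≤ (1 / 2 : ℝ) ^ (F j ∩ Z).card := by
    have : Real.exp (-1) ≤ 1 / 2 := by
      rw [Real.exp_neg, inv_le_comm₀ (Real.exp_pos 1) (by norm_num)]
      linarith [Real.add_one_le_exp (1 : ℝ)]
    calc Real.exp (-((F j ∩ Z).card : ℝ)) = Real.exp (-1) ^ (F j ∩ Z).card := by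
          rw [← Real.exp_nat_mul]; ring_nf
      _ ≤ _ := pow_le_pow_left₀ (Real.exp_pos _).le this _
  have hJ0 : (0 : ℝ) < Fintype.card J := by exact_mod_cast Fintype.card_pos
  have h4 : Real.exp (-((F j ∩ Z).card : ℝ)) ≤
      Real.exp (Real.log (Fintype.card J) + -(δ / 4 * N)) := by
    rw [Real.exp_add, Real.exp_log hJ0]
    exact (h3.trans (h1.trans hZ)).trans (by gcongr)
  have := Real.exp_le_exp.1 h4
  linarith

end Sampling

section Absorption

variable {h n : ℕ} {H : SimpleGraph (Fin h)} {G : SimpleGraph (Fin n)}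

/-- The vertices `v` of `Fin n` with `a ≤ v < b`. -/
def finSegment (n a b : ℕ) : Finset (Fin n) :=
  Finset.univ.filter fun v => a ≤ (v : ℕ) ∧ (v : ℕ) < b

@[simp] lemma mem_finSegment {a b : ℕ} {v : Fin n} :
    v ∈ finSegment n a b ↔ a ≤ (v : ℕ) ∧ (v : ℕ) < b := by
  simp [finSegment]

lemma card_finSegment {a b : ℕ} (hb : b ≤ n) : (finSegment n a b).card = b - a := by
  rw [← Nat.card_Ico, ← Finset.card_map Fin.valEmbedding]
  congr 1
  ext x
  simp only [Finset.mem_map, mem_finSegment, Fin.valEmbedding_apply, Finset.mem_Ico]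
  exact ⟨by rintro ⟨v, hv, rfl⟩; exact hv, fun hx => ⟨⟨x, by omega⟩, hx, rfl⟩⟩

lemma card_finSegment_le {a b : ℕ} : (finSegment n a b).card ≤ b - a := by
  rw [← Nat.card_Ico, ← Finset.card_map Fin.valEmbedding]
  refine Finset.card_le_card fun x hx => ?_
  obtain ⟨v, hv, rfl⟩ := Finset.mem_map.1 hx
  simpa using hv

open scoped Classical in
lemma odeg_eq_card_filter (v : Fin n) : odeg G v = (Finset.univ.filter (G.Adj v)).card := by
  rw [odeg, ← Set.ncard_coe_finset]
  congr 1
  ext u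
  simp

open scoped Classical in
/-- The last `b` vertices send many edges both before some point `p` and after `p + b`. -/
lemma exists_threshold {η : ℝ} {b : ℕ} (hb : 1 ≤ b) (hbη : 8 * (b : ℝ) ≤ η * n)
    (hη : 8 ≤ η * n) (hdeg : ∀ v : Fin n, η * n ≤ (odeg G v : ℝ)) (hbn : b ≤ n) :
    ∃ p : ℕ, p + b + b ≤ n ∧
      b ≤ 2 * ((finSegment n (n - b) n).filter fun v =>
        η * n / 4 ≤ (((finSegment n (p + b) n).filter (G.Adj v)).card : ℝ)).card ∧
      b ≤ 2 * ((finSegment n (n - b) n).filter fun v =>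
        η * n / 2 ≤ (((finSegment n 0 p).filter (G.Adj v)).card : ℝ)).card := by
  have hR : (finSegment n (n - b) n).card = b := by rw [card_finSegment le_rfl]; omega
  have hex : ∃ p, b ≤ 2 * ((finSegment n (n - b) n).filter fun v =>
      η * n / 2 ≤ (((finSegment n 0 p).filter (G.Adj v)).card : ℝ)).card := by
    refine ⟨n, ?_⟩
    rw [Finset.filter_true_of_mem, hR]
    · omega
    · intro v _
      have h1 : (finSegment n 0 n).filter (G.Adj v) = Finset.univ.filter (G.Adj v) := by
        ext u; simp
      rw [h1, ← odeg_eq_card_filter]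
      linarith [hdeg v]
  set p := Nat.find hex with hp
  have hp1 := Nat.find_spec hex
  have hp0 : p ≠ 0 := by
    intro hp0
    rw [← hp, hp0, Finset.filter_false_of_mem] at hp1
    · simp at hp1; omega
    · intro v _
      have : finSegment n 0 0 = ∅ := by ext; simp
      rw [this]
      simp
      linarith
  have hp2 := Nat.find_min hex (m := p - 1) (by omega)
  have hlarge : b ≤ 2 * ((finSegment n (n - b) n).filter fun v =>
      η * n / 4 ≤ (((finSegment n (p + b) n).filter (G.Adj v)).card : ℝ)).card := by
    have h1 := Finset.card_filter_add_card_filter_not (s := finSegment n (n - b) n) fun v =>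
      η * n / 2 ≤ (((finSegment n 0 (p - 1)).filter (G.Adj v)).card : ℝ)
    rw [hR] at h1
    refine le_trans (b := 2 * ((finSegment n (n - b) n).filter fun v =>
      ¬ η * n / 2 ≤ (((finSegment n 0 (p - 1)).filter (G.Adj v)).card : ℝ)).card) (by omega) ?_
    refine Nat.mul_le_mul_left 2 (Finset.card_le_card
      (Finset.monotone_filter_right _ fun v _ hv => ?_))
    rw [not_le] at hv
    have h2 : Finset.univ.filter (G.Adj v) ⊆ ((finSegment n 0 (p - 1)).filter (G.Adj v) ∪
        (finSegment n (p + b) n).filter (G.Adj v)) ∪ finSegment n (p - 1) (p + b) := by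
      intro u hu
      have := u.2
      simp only [Finset.mem_union, Finset.mem_filter, mem_finSegment, Finset.mem_univ,
        true_and] at hu ⊢
      simp only [hu, and_true]
      omega
    have h3 := (Finset.card_le_card h2).trans ((Finset.card_union_le _ _).trans
      (Nat.add_le_add_right (Finset.card_union_le _ _) _))
    rw [← odeg_eq_card_filter] at h3
    have h4 : (finSegment n (p - 1) (p + b)).card ≤ b + 1 :=
      card_finSegment_le.trans (by omega)
    have h5 : (odeg G v : ℝ) ≤ (((finSegment n 0 (p - 1)).filter (G.Adj v)).card : ℝ) +
        (((finSegment n (p + b) n).filter (G.Adj v)).card : ℝ) + (b + 1) := by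
      exact_mod_cast h3.trans (by omega)
    linarith [hdeg v]
  refine ⟨p, ?_, hlarge, hp1⟩
  obtain ⟨v, hv⟩ := Finset.card_pos.1 (show 0 < ((finSegment n (n - b) n).filter fun v =>
      η * n / 4 ≤ (((finSegment n (p + b) n).filter (G.Adj v)).card : ℝ)).card by omega)
  have h1 := (Finset.mem_filter.1 hv).2
  have h2 : ((finSegment n (p + b) n).filter (G.Adj v)).card ≤ n - (p + b) :=
    (Finset.card_filter_le _ _).trans card_finSegment_le
  have h3 : ((2 * b : ℕ) : ℝ) ≤ ((n - (p + b) : ℕ) : ℝ) := by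
    push_cast
    have : (((finSegment n (p + b) n).filter (G.Adj v)).card : ℝ) ≤ ((n - (p + b) : ℕ) : ℝ) := by
      exact_mod_cast h2
    linarith
  have : 2 * b ≤ n - (p + b) := by exact_mod_cast h3
  omega

open scoped Classical in
lemma HasIsolatedFirst.exists_isBlock (hH : HasIsolatedFirst H) (h2 : 2 ≤ h) {δ : ℝ}
    (hδ : 0 < δ) :
    ∃ M : ℕ, ∀ {n : ℕ} (G : SimpleGraph (Fin n)) (A B I : Finset (Fin n)) (u : ℕ),
      M + u ≤ A.card → M ≤ n →
      (∀ a ∈ A, δ * n + u ≤ ((B.filter (G.Adj a)).card : ℝ)) →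
      (∀ z ∈ I, ∀ a ∈ A, z < a) →
      ((∀ z ∈ I, ∀ y ∈ B, z < y) ∨ (∀ z ∈ I, ∀ y ∈ B, y < z)) →
      ∀ U : Finset (Fin n), U.card ≤ u →
        ∃ S, IsBlock H G I S ∧ S.card ≤ h * (h - 1) ∧ Disjoint S U := by
  have hpos : 2 ≤ h * (h - 1) := Nat.mul_le_mul h2 (show 1 ≤ h - 1 by omega)
  have heven : 2 * (h * (h - 1) / 2) = h * (h - 1) :=
    Nat.two_mul_div_two_of_even (Nat.even_mul_pred_self h)
  obtain ⟨M, hM⟩ := exists_orderedBiclique hδ (t := h * (h - 1) / 2) (by omega)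
  refine ⟨M, fun {n} G A B I u hA hn hdeg hIA hIB U hU => ?_⟩
  obtain ⟨X, hX, Y, hY, hXc, hYc, hXY⟩ := hM G (A \ U) (B \ U) n
    (by have := Finset.le_card_sdiff U A; omega) hn
    ((Finset.card_le_univ _).trans_eq (Fintype.card_fin n)) (fun a ha => by
      have h1 := hdeg a (Finset.mem_sdiff.1 ha).1
      have h2 : B.filter (G.Adj a) ⊆ (B \ U).filter (G.Adj a) ∪ U := fun x hx => by
        simp only [Finset.mem_union, Finset.mem_filter, Finset.mem_sdiff] at hx ⊢
        tauto
      have h3 : ((B.filter (G.Adj a)).card : ℝ) ≤ ((B \ U).filter (G.Adj a)).card + u := by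
        exact_mod_cast (Finset.card_le_card h2).trans ((Finset.card_union_le _ _).trans (by omega))
      linarith)
  obtain ⟨x₀, hx₀⟩ := Finset.card_pos.1 (show 0 < X.card by omega)
  obtain ⟨y₀, hy₀⟩ := Finset.card_pos.1 (show 0 < Y.card by omega)
  have hXA : ∀ z ∈ I, ∀ x ∈ X, z < x := fun z hz x hx => hIA z hz x (Finset.mem_sdiff.1 (hX hx)).1
  have hYB : ∀ y ∈ Y, y ∈ B := fun y hy => (Finset.mem_sdiff.1 (hY hy)).1
  have hdisj : Disjoint (X ∪ Y) U := Finset.disjoint_union_left.2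
    ⟨Finset.disjoint_left.2 fun x hx => (Finset.mem_sdiff.1 (hX hx)).2,
      Finset.disjoint_left.2 fun x hx => (Finset.mem_sdiff.1 (hY hx)).2⟩
  have hcard : (X ∪ Y).card ≤ h * (h - 1) := (Finset.card_union_le _ _).trans (by omega)
  refine ⟨X ∪ Y, ?_, hcard, hdisj⟩
  rcases hXY with hXY | hYX
  · refine hH.isBlock_biclique h2 hXY (by omega) (by omega) (Or.inl fun z hz => ⟨hXA z hz, ?_⟩)
    intro y hy
    exact (hXA z hz x₀ hx₀).trans (hXY x₀ hx₀ y hy).1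
  · rw [Finset.union_comm]
    refine hH.isBlock_biclique h2 hYX (by omega) (by omega) ?_
    rcases hIB with hIB | hIB
    · exact Or.inl fun z hz => ⟨fun y hy => hIB z hz y (hYB y hy), hXA z hz⟩
    · exact Or.inr fun z hz => ⟨fun y hy => hIB z hz y (hYB y hy), hXA z hz⟩

/-- Combining a flexible set `Z` with absorbers for two overlapping intervals. -/
lemma hasPerfectTilingOn_of_absorbers (h1 : 1 ≤ h) {p q r m : ℕ}
    {Z S₁ S₂ W : Finset (Fin n)} (hZ : Z ⊆ finSegment n 0 r)
    (hZS₁ : Disjoint S₁ Z) (hS : Disjoint S₂ (Z ∪ S₁)) (hW : Disjoint W (Z ∪ S₁ ∪ S₂))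
    (hS₁ : ∀ j ≤ m, ∀ Q ⊆ finSegment n 0 q, Q.card = h * j → Disjoint S₁ Q →
      HasPerfectTilingOn H G (S₁ ∪ Q))
    (hS₂ : ∀ j ≤ m, ∀ Q ⊆ finSegment n p r, Q.card = h * j → Disjoint S₂ Q →
      HasPerfectTilingOn H G (S₂ ∪ Q))
    (hZh : h ∣ Z.card) (hWh : h ∣ W.card) (hm : Z.card + W.card ≤ m)
    (hcov : ∃ T ⊆ Z, T.card = (h - 1) * (W \ finSegment n 0 r).card ∧
      HasPerfectTilingOn H G (T ∪ (W \ finSegment n 0 r)))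
    (hov : (h - 1) * W.card + h ≤ (finSegment n p q ∩ Z).card) :
    HasPerfectTilingOn H G (Z ∪ S₁ ∪ S₂ ∪ W) := by
  obtain ⟨T, hTZ, hTc, hT⟩ := hcov
  rw [Finset.disjoint_union_right, Finset.disjoint_union_right] at hW
  rw [Finset.disjoint_union_right] at hS
  obtain ⟨⟨hWZ, hWS₁⟩, hWS₂⟩ := hW
  obtain ⟨hS₂Z, hS₂S₁⟩ := hS
  set W₁ := W \ finSegment n 0 r with hW₁
  set W₀ := W ∩ finSegment n 0 r with hW₀
  have hWc : W₁.card + W₀.card = W.card := Finset.card_sdiff_add_card_inter _ _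
  set D := (Z \ T) ∪ W₀ with hD
  have hDc : D.card + h * W₁.card = Z.card + W.card := by
    have e1 : D.card = (Z \ T).card + W₀.card := Finset.card_union_of_disjoint
      (hWZ.symm.mono Finset.sdiff_subset Finset.inter_subset_left)
    have e2 := Finset.card_sdiff_add_card_eq_card hTZ
    obtain ⟨k, rfl⟩ := Nat.exists_eq_add_of_le' h1
    rw [Nat.add_sub_cancel] at hTc
    rw [Nat.succ_mul]
    omega
  have hDdvd : h ∣ D.card :=
    (Nat.dvd_add_left (dvd_mul_right h W₁.card)).1 (hDc ▸ dvd_add hZh hWh)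
  have hDr : D ⊆ finSegment n 0 r := Finset.union_subset (Finset.sdiff_subset.trans hZ)
    Finset.inter_subset_right
  set D₁ := D ∩ finSegment n 0 p with hD₁
  obtain ⟨E, hE, hEc⟩ := Finset.exists_subset_card_eq
    (s := (finSegment n p q ∩ Z) \ T) (n := h - D₁.card % h) (by
      have e1 := Finset.le_card_sdiff T (finSegment n p q ∩ Z)
      have e2 : (h - 1) * W₁.card ≤ (h - 1) * W.card := Nat.mul_le_mul_left _ (by omega)
      omega)
  have hED : E ⊆ D := fun x hx => Finset.mem_union_left _ (by
    have := hE hx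
    simp only [Finset.mem_sdiff, Finset.mem_inter] at this ⊢
    exact ⟨this.1.2, this.2⟩)
  have hEpq : E ⊆ finSegment n p q := fun x hx =>
    (Finset.mem_inter.1 (Finset.mem_sdiff.1 (hE hx)).1).1
  have hpq : p ≤ q := by
    obtain ⟨x, hx⟩ := Finset.card_pos.1 (show 0 < (finSegment n p q ∩ Z).card by omega)
    have := mem_finSegment.1 (Finset.mem_inter.1 hx).1
    omega
  have hD₁E : Disjoint D₁ E := Finset.disjoint_left.2 fun x hx hx' => by
    have a1 := mem_finSegment.1 (Finset.mem_inter.1 hx).2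
    have a2 := mem_finSegment.1 (hEpq hx')
    omega
  have hQD : D₁ ∪ E ⊆ D := Finset.union_subset Finset.inter_subset_left hED
  have hQ₁ : h ∣ (D₁ ∪ E).card := by
    rw [Finset.card_union_of_disjoint hD₁E, hEc]
    have a1 := Nat.mod_lt D₁.card h1
    have a2 := Nat.div_add_mod D₁.card h
    have : D₁.card + (h - D₁.card % h) = h * (D₁.card / h + 1) := by
      rw [Nat.mul_succ]; omega
    rw [this]
    exact dvd_mul_right _ _
  obtain ⟨j₁, hj₁⟩ := hQ₁
  have hQ₂ : h ∣ (D \ (D₁ ∪ E)).card := by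
    rw [Finset.card_sdiff_of_subset hQD, hj₁]
    exact Nat.dvd_sub hDdvd (dvd_mul_right _ _)
  obtain ⟨j₂, hj₂⟩ := hQ₂
  have hDm : D.card ≤ m := by omega
  have hjm : ∀ {Q : Finset (Fin n)} {j : ℕ}, Q ⊆ D → Q.card = h * j → j ≤ m := fun hQ hj =>
    ((Nat.le_mul_of_pos_left _ h1).trans (hj ▸ Finset.card_le_card hQ)).trans hDm
  have hDZW : D ⊆ Z ∪ W := Finset.union_subset_union Finset.sdiff_subset Finset.inter_subset_left
  have hDS₁ : Disjoint S₁ D := Disjoint.mono_right hDZW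
    (Finset.disjoint_union_right.2 ⟨hZS₁, hWS₁.symm⟩)
  have hDS₂ : Disjoint S₂ D := Disjoint.mono_right hDZW
    (Finset.disjoint_union_right.2 ⟨hS₂Z, hWS₂.symm⟩)
  have t₁ := hS₁ j₁ (hjm hQD hj₁) (D₁ ∪ E) (by
    intro x hx
    rcases Finset.mem_union.1 hx with hx | hx
    · have := mem_finSegment.1 (Finset.mem_inter.1 hx).2
      rw [mem_finSegment]; omega
    · have := mem_finSegment.1 (hEpq hx)
      rw [mem_finSegment]; omega) hj₁ (hDS₁.mono_right hQD)
  have t₂ := hS₂ j₂ (hjm Finset.sdiff_subset hj₂) (D \ (D₁ ∪ E)) (by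
    intro x hx
    obtain ⟨a1, a2⟩ := Finset.mem_sdiff.1 hx
    have a3 := mem_finSegment.1 (hDr a1)
    have a4 : x ∉ finSegment n 0 p := fun a4 =>
      a2 (Finset.mem_union_left _ (Finset.mem_inter.2 ⟨a1, a4⟩))
    rw [mem_finSegment] at a4 ⊢
    omega) hj₂ (hDS₂.mono_right Finset.sdiff_subset)
  have t₁₂ := t₁.union t₂ (by
    rw [Finset.disjoint_union_left, Finset.disjoint_union_right, Finset.disjoint_union_right]
    exact ⟨⟨hS₂S₁.symm, hDS₁.mono_right Finset.sdiff_subset⟩,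
      (hDS₂.mono_right hQD).symm, Finset.disjoint_sdiff⟩)
  have e₁₂ : S₁ ∪ (D₁ ∪ E) ∪ (S₂ ∪ D \ (D₁ ∪ E)) = S₁ ∪ S₂ ∪ D := by
    rw [Finset.union_union_union_comm, Finset.union_sdiff_of_subset hQD]
  rw [e₁₂] at t₁₂
  have hW₁W : W₁ ⊆ W := Finset.sdiff_subset
  have t := t₁₂.union hT (by
    have b1 : Disjoint D (T ∪ W₁) := by
      rw [Finset.disjoint_union_left, Finset.disjoint_union_right, Finset.disjoint_union_right]
      exact ⟨⟨Finset.sdiff_disjoint, hWZ.symm.mono Finset.sdiff_subset hW₁W⟩,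
        hWZ.mono Finset.inter_subset_left hTZ,
        (Finset.disjoint_sdiff_inter W (finSegment n 0 r)).symm⟩
    rw [Finset.disjoint_union_left, Finset.disjoint_union_left]
    exact ⟨⟨Finset.disjoint_union_right.2 ⟨hZS₁.mono_right hTZ, hWS₁.symm.mono_right hW₁W⟩,
      Finset.disjoint_union_right.2 ⟨hS₂Z.mono_right hTZ, hWS₂.symm.mono_right hW₁W⟩⟩, b1⟩)
  convert t using 1
  ext x
  have : x ∈ T → x ∈ Z := fun hx => hTZ hx
  simp only [hD, hW₀, hW₁, Finset.mem_union, Finset.mem_sdiff, Finset.mem_inter]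
  tauto

end Absorption

section Strong

variable {h n : ℕ} {H : SimpleGraph (Fin h)}

open scoped Classical in
/-- The absorbing set, given numerical parameters: `N` is the size of the flexible set, `w` bounds
the number of absorbed vertices, and `b` is the length of the final interval of `Fin n`. -/
lemma HasIsolatedFirst.exists_absorbing_of_parameters (hH : HasIsolatedFirst H) (h2 : 2 ≤ h)
    {η : ℝ} (hη : 0 < η) (hη1 : η ≤ 1) :
    ∃ M : ℕ, ∀ {n : ℕ} (G : SimpleGraph (Fin n)) (N w b : ℕ),
      (∀ v : Fin n, η * n ≤ (odeg G v : ℝ)) →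
      1 ≤ b → 8 * (b : ℝ) ≤ η * n → η * n ≤ 16 * b →
      h ∣ N → w ≤ N → M ≤ N →
      4 * (M + (N + 4 * N * (h * (h - 1)))) ≤ b →
      Real.log (n + 1) ≤ η / 128 * N →
      (h - 1 : ℕ) * (w : ℝ) + h ≤ η / 256 * N →
      ∃ S : Finset (Fin n), S.card ≤ N + 4 * N * (h * (h - 1)) ∧
        ∀ W : Finset (Fin n), Disjoint W S → h ∣ W.card → W.card ≤ w →
          HasPerfectTilingOn H G (S ∪ W) := by
  obtain ⟨M₁, hM₁⟩ := hH.exists_copy_last h2 (θ := η / 256) (by positivity)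
  obtain ⟨M₂, hM₂⟩ := hH.exists_isBlock h2 (δ := η / 8) (by positivity)
  refine ⟨M₁ + M₂, fun {n} G N w b hdeg hb1 hb8 hb16 hN hwN hMN hub hlog hw => ?_⟩
  have hb1' : (1 : ℝ) ≤ b := by exact_mod_cast hb1
  have hbn : b ≤ n := by
    have : (b : ℝ) ≤ n := by nlinarith [Nat.cast_nonneg (α := ℝ) n]
    exact_mod_cast this
  set u := N + 4 * N * (h * (h - 1)) with hu
  have hub' : 4 * ((M₁ : ℝ) + M₂ + u) ≤ b := by exact_mod_cast hub
  have hM₁0 : (0 : ℝ) ≤ M₁ := Nat.cast_nonneg _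
  have hM₂0 : (0 : ℝ) ≤ M₂ := Nat.cast_nonneg _
  have hNu : (N : ℝ) ≤ u := by exact_mod_cast Nat.le_add_right _ _
  obtain ⟨p, hpb, hp₁, hp₂⟩ := exists_threshold (G := G) hb1 hb8 (by linarith) hdeg hbn
  set R₁ := (finSegment n (n - b) n).filter fun v =>
    η * n / 4 ≤ (((finSegment n (p + b) n).filter (G.Adj v)).card : ℝ) with hR₁
  set R₂ := (finSegment n (n - b) n).filter fun v =>
    η * n / 2 ≤ (((finSegment n 0 p).filter (G.Adj v)).card : ℝ) with hR₂
  obtain ⟨K, hK⟩ : ∃ K, K = 2 * N * (h * (h - 1)) := ⟨_, rfl⟩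
  have huK : u = N + 2 * K := by rw [hu, hK]; ring
  have hr : ∀ v : Fin n, η / 16 * n ≤ (((finSegment n 0 (n - b)).filter (G.Adj v)).card : ℝ) := by
    intro v
    have h1 : Finset.univ.filter (G.Adj v) ⊆
        (finSegment n 0 (n - b)).filter (G.Adj v) ∪ finSegment n (n - b) n := by
      intro x hx
      have := x.2
      simp only [Finset.mem_union, Finset.mem_filter, mem_finSegment, Finset.mem_univ,
        true_and] at hx ⊢
      simp only [hx, and_true]
      omega
    have h2 := (Finset.card_le_card h1).trans (Finset.card_union_le _ _)
    rw [← odeg_eq_card_filter, card_finSegment le_rfl, Nat.sub_sub_self hbn] at h2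
    have h3 : (odeg G v : ℝ) ≤ ((finSegment n 0 (n - b)).filter (G.Adj v)).card + b := by
      exact_mod_cast h2
    linarith [hdeg v]
  obtain ⟨Z, hZ, hZN, hZF⟩ := exists_sample (A := finSegment n 0 (n - b))
    (F := fun j : Option (Fin n) => j.elim (finSegment n p (p + b))
      fun v => (finSegment n 0 (n - b)).filter (G.Adj v))
    (by
      rintro (_ | v)
      · intro x hx
        have := mem_finSegment.1 hx
        rw [mem_finSegment]; omega
      · exact Finset.filter_subset _ _)
    (δ := η / 16) (by positivity) (by linarith) (by
      rintro (_ | v)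
      · rw [Option.elim_none, card_finSegment (by omega), Nat.add_sub_cancel_left]
        linarith
      · exact hr v) N (by linarith) (by
      rw [Fintype.card_option, Fintype.card_fin]
      push_cast
      linarith)
  have hZpq : η / 128 * N ≤ ((finSegment n p (p + b) ∩ Z).card : ℝ) := by
    have := hZF none
    rw [Option.elim_none] at this
    linarith
  have hZv : ∀ v, η / 128 * N ≤ ((Z.filter (G.Adj v)).card : ℝ) := by
    intro v
    have h1 := hZF (some v)
    have h2 : (finSegment n 0 (n - b)).filter (G.Adj v) ∩ Z ⊆ Z.filter (G.Adj v) := fun x hx => by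
      simp only [Finset.mem_inter, Finset.mem_filter] at hx ⊢
      exact ⟨hx.2, hx.1.2⟩
    have h3 : ((((finSegment n 0 (n - b)).filter (G.Adj v) ∩ Z).card : ℕ) : ℝ) ≤
        (Z.filter (G.Adj v)).card := by exact_mod_cast Finset.card_le_card h2
    rw [Option.elim_some] at h1
    linarith
  have hlt : ∀ a ∈ finSegment n (n - b) n, ∀ z : Fin n, (z : ℕ) < n - b → z < a := fun a ha z hz =>
    Fin.lt_def.2 (hz.trans_le (mem_finSegment.1 ha).1)
  obtain ⟨S₁, hS₁Z, hS₁c, hS₁⟩ := exists_absorber_of_blocks (H := H) (G := G)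
    (hM₂ G R₁ (finSegment n (p + b) n) (finSegment n 0 (p + b)) u (by omega) (by omega)
      (fun a ha => by
        have := (Finset.mem_filter.1 ha).2
        linarith)
      (fun z hz a ha => hlt a (Finset.mem_filter.1 ha).1 z (by
        have := (mem_finSegment.1 hz).2
        omega))
      (Or.inl fun z hz y hy => Fin.lt_def.2
        ((mem_finSegment.1 hz).2.trans_le (mem_finSegment.1 hy).1)))
    (2 * N) Z (by rw [hZN]; omega)
  obtain ⟨S₂, hS₂Z, hS₂c, hS₂⟩ := exists_absorber_of_blocks (H := H) (G := G)
    (hM₂ G R₂ (finSegment n 0 p) (finSegment n p (n - b)) u (by omega) (by omega)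
      (fun a ha => by
        have := (Finset.mem_filter.1 ha).2
        linarith)
      (fun z hz a ha => hlt a (Finset.mem_filter.1 ha).1 z (mem_finSegment.1 hz).2)
      (Or.inr fun z hz y hy => Fin.lt_def.2
        ((mem_finSegment.1 hy).2.trans_le (mem_finSegment.1 hz).1)))
    (2 * N) (Z ∪ S₁) (by
      have := Finset.card_union_le Z S₁
      omega)
  refine ⟨Z ∪ S₁ ∪ S₂, ?_, fun W hW hWh hWw => ?_⟩
  · have e1 := Finset.card_union_le Z S₁
    have e2 := Finset.card_union_le (Z ∪ S₁) S₂
    omega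
  have hWw' : ((h - 1 : ℕ) : ℝ) * W.card ≤ (h - 1 : ℕ) * (w : ℝ) := by
    exact_mod_cast Nat.mul_le_mul_left _ hWw
  have hN0 : 0 ≤ η / 256 * N := by positivity
  refine hasPerfectTilingOn_of_absorbers (by omega) hZ hS₁Z hS₂Z hW hS₁ hS₂ (hZN ▸ hN) hWh
    (by omega) ?_ ?_
  · refine exists_cover (L := (h - 1) * W.card) ?_ ?_
      (Nat.mul_le_mul_left _ (Finset.card_le_card Finset.sdiff_subset))
    · exact Finset.disjoint_left.2 fun x hx hx' => (Finset.mem_sdiff.1 hx').2 (hZ hx)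
    · intro U hU v hv
      refine hM₁ G (Z \ U) N v (by omega) ((Finset.card_le_card Finset.sdiff_subset).trans hZN.le)
        (fun z hz => hlt v ?_ z (mem_finSegment.1 (hZ (Finset.mem_sdiff.1 hz).1)).2)
        (fun x _ => ?_)
      · have h1 := (Finset.mem_sdiff.1 hv).2
        have := v.2
        rw [mem_finSegment] at h1 ⊢
        omega
      · have h1 : Z.filter (G.Adj x) ⊆ (Z \ U).filter (G.Adj x) ∪ U := fun y hy => by
          simp only [Finset.mem_union, Finset.mem_filter, Finset.mem_sdiff] at hy ⊢
          tauto
        have h3 : ((Z.filter (G.Adj x)).card : ℝ) ≤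
            ((Z \ U).filter (G.Adj x)).card + ((h - 1 : ℕ) : ℝ) * W.card := by
          exact_mod_cast (Finset.card_le_card h1).trans
            ((Finset.card_union_le _ _).trans (by omega))
        have := hZv x
        have : (0 : ℝ) ≤ h := Nat.cast_nonneg _
        linarith
  · have : ((h - 1 : ℕ) : ℝ) * W.card + h ≤ ((finSegment n p (p + b) ∩ Z).card : ℝ) := by linarith
    exact_mod_cast this

set_option maxHeartbeats 800000 in
open Filter in
/-- The strong absorbing theorem when the first vertex of `H` is isolated. -/
lemma HasIsolatedFirst.exists_absorbing (hH : HasIsolatedFirst H) (h2 : 2 ≤ h) {η : ℝ}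
    (hη : 0 < η) :
    ∃ (n₀ : ℕ) (ν : ℝ), 0 < ν ∧ ∀ n : ℕ, n₀ ≤ n → ∀ G : SimpleGraph (Fin n),
      (∀ v : Fin n, η * n ≤ (odeg G v : ℝ)) →
      ∃ S : Finset (Fin n), (S.card : ℝ) ≤ ν * n ∧
        ∀ W : Finset (Fin n), Disjoint W S → h ∣ W.card →
          (W.card : ℝ) ≤ ν ^ 3 * n → HasPerfectTilingOn H G (S ∪ W) := by
  wlog hη1 : η ≤ 1 generalizing η
  · obtain ⟨n₀, ν, hν, hmain⟩ := this one_pos le_rfl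
    refine ⟨n₀, ν, hν, fun n hn G hdeg => hmain n hn G fun v => (hdeg v).trans' ?_⟩
    gcongr
    exact (not_le.1 hη1).le
  obtain ⟨M, hM⟩ := hH.exists_absorbing_of_parameters h2 hη hη1
  have hh : (2 : ℝ) ≤ h := by exact_mod_cast h2
  set ν : ℝ := η / (1000 * h ^ 3) with hν
  have hν0 : 0 < ν := by positivity
  have hνh : 1000 * (h : ℝ) ^ 3 * ν = η := by rw [hν]; field_simp
  have hh3 : (8 : ℝ) ≤ (h : ℝ) ^ 3 := by
    calc (8 : ℝ) = 2 ^ 3 := by norm_num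
      _ ≤ _ := by gcongr
  have hνη : 8000 * ν ≤ η := by nlinarith
  have hlarge : ∀ (C : ℝ) {k : ℝ}, 0 < k → ∀ᶠ n : ℕ in atTop, C ≤ k * n := fun C k hk =>
    (tendsto_natCast_atTop_atTop.const_mul_atTop hk).eventually_ge_atTop C
  have hev := (hlarge 16 hη).and <| (hlarge (M + 1) (pow_pos hν0 2)).and <|
    (hlarge 512 (k := η * ν ^ 2) (by positivity)).and <| (hlarge (128 * M) hη).and
    (hlarge 2 (k := (η / 128 * ν ^ 2) ^ 2) (by positivity))
  obtain ⟨n₀, hn₀⟩ := eventually_atTop.1 hev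
  refine ⟨n₀, ν, hν0, fun n hn G hdeg => ?_⟩
  obtain ⟨k1, k2, k3, k4, k5⟩ := hn₀ n hn
  have hM0 : (0 : ℝ) ≤ M := Nat.cast_nonneg _
  set x : ℝ := ν ^ 2 * n with hx
  have hx3 : ν ^ 3 * n = ν * x := by rw [hx]; ring
  have hx0 : 1 ≤ x := by linarith
  set b := ⌊η * n / 8⌋₊ with hb
  have hb8 : (b : ℝ) ≤ η * n / 8 := Nat.floor_le (by positivity)
  have hb16 : η * n / 8 < b + 1 := Nat.lt_floor_add_one _
  set N := h * ⌈x⌉₊ with hN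
  have hNx : h * x ≤ N := by
    rw [hN, Nat.cast_mul]
    gcongr
    exact Nat.le_ceil x
  have hNx' : (N : ℝ) ≤ 2 * h * x := by
    rw [hN, Nat.cast_mul]
    have := Nat.ceil_lt_add_one (by linarith : 0 ≤ x)
    nlinarith
  set u := N + 4 * N * (h * (h - 1)) with hu
  have hux : (u : ℝ) ≤ ν * n / 100 := by
    have h1 : h * (h - 1) ≤ h ^ 2 := by rw [sq]; gcongr; omega
    have h3 : u ≤ N + 4 * N * h ^ 2 := by rw [hu]; gcongr
    have h4 : (u : ℝ) ≤ N + 4 * N * (h : ℝ) ^ 2 := by exact_mod_cast h3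
    have h5 : (N : ℝ) * (1 + 4 * (h : ℝ) ^ 2) ≤ (2 * h * x) * (5 * (h : ℝ) ^ 2) := by
      gcongr
      nlinarith
    have h6 : (2 * h * x) * (5 * (h : ℝ) ^ 2) = η * (ν * n / 100) := by
      rw [hx, ← hνh]; ring
    have h7 : η * (ν * n / 100) ≤ 1 * (ν * n / 100) := by gcongr
    linarith
  have hνn : 8000 * (ν * n) ≤ η * n := by
    rw [← mul_assoc]; gcongr
  have hn0 : (0 : ℝ) ≤ n := Nat.cast_nonneg _
  obtain ⟨S, hS, hSW⟩ := hM G N ⌊ν ^ 3 * n⌋₊ b hdeg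
    (by
      have : (1 : ℝ) ≤ b := by linarith
      exact_mod_cast this)
    (by linarith) (by linarith) (dvd_mul_right _ _)
    (by
      have h1 : ((⌊ν ^ 3 * n⌋₊ : ℕ) : ℝ) ≤ N := by
        refine (Nat.floor_le (by positivity)).trans (le_trans ?_ hNx)
        rw [hx3]
        gcongr
        linarith
      exact_mod_cast h1)
    (by
      have : (M : ℝ) ≤ N := by nlinarith
      exact_mod_cast this)
    (by
      have : 4 * ((M : ℝ) + u) ≤ b := by linarith
      exact_mod_cast this)
    (by
      rw [Real.log_le_iff_le_exp (by positivity)]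
      set c : ℝ := η / 128 * ν ^ 2 with hc
      have hc0 : 0 ≤ c * n := by positivity
      have h1 := Real.quadratic_le_exp_of_nonneg hc0
      have h2 : c * n ≤ η / 128 * N := by
        rw [hc, mul_assoc]
        gcongr
        nlinarith
      refine le_trans ?_ (h1.trans (Real.exp_le_exp.2 h2))
      nlinarith)
    (by
      have h1 : ((⌊ν ^ 3 * n⌋₊ : ℕ) : ℝ) ≤ ν * x := hx3 ▸ Nat.floor_le (by positivity)
      have h3 : ((h - 1 : ℕ) : ℝ) ≤ h := by exact_mod_cast Nat.sub_le _ _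
      calc ((h - 1 : ℕ) : ℝ) * (⌊ν ^ 3 * n⌋₊ : ℕ) + h ≤ h * (ν * x) + h := by gcongr
        _ = h * (ν * x + 1) := by ring
        _ ≤ h * (η / 256 * x) := by
          gcongr
          have h4 : 512 * (ν * x) ≤ η * x := by nlinarith
          have h5 : η * ν ^ 2 * n = η * x := by rw [hx]; ring
          linarith
        _ ≤ η / 256 * N := by nlinarith)
  refine ⟨S, ?_, fun W hW hWh hWc => hSW W hW hWh (Nat.le_floor hWc)⟩
  have h1 : (S.card : ℝ) ≤ u := by exact_mod_cast hS
  have : 0 ≤ ν * n := by positivity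
  linarith

end Strong

section Reversal

variable {h n : ℕ} {H : SimpleGraph (Fin h)} {G : SimpleGraph (Fin n)}

lemma PropertyA.middle (hA : PropertyA H) (i j : Fin h) (hij : H.Adj i j) (hlt : i < j) :
    (i : ℕ) + 2 ≤ (h + 1) / 2 ∧ h / 2 + 1 ≤ (j : ℕ) := by
  have h1 := hA.1 i j
  have h2 := hA.2 i j
  rw [Fin.lt_def] at hlt
  constructor
  · by_contra hc
    exact h2 (by omega) (by omega) hij
  · by_contra hc
    exact h1 (by omega) (by omega) hij

lemma HasIsolatedFirst.of_middle
    (hmid : ∀ i j, H.Adj i j → i < j → (i : ℕ) + 2 ≤ (h + 1) / 2 ∧ h / 2 + 1 ≤ (j : ℕ))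
    (hfirst : ∀ i j, H.Adj i j → (i : ℕ) ≠ 0) (h1 : 1 ≤ h)
    (hlast : ∀ k l, H.Adj k l → (l : ℕ) + 1 = h → (∀ i, H.Adj i l → k ≤ i) →
      ∀ i j, H.Adj i j → i < j → (j : ℕ) + 1 < h → i < k) : HasIsolatedFirst H := by
  refine ⟨hmid, hfirst, ?_⟩
  have hlo : h - 1 < h := by omega
  by_cases hex : ∃ k, H.Adj k ⟨h - 1, hlo⟩
  · obtain ⟨k, hk, hmin⟩ := WellFounded.has_min (wellFounded_lt (α := Fin h))
      {k | H.Adj k ⟨h - 1, hlo⟩} hex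
    replace hk : H.Adj k ⟨h - 1, hlo⟩ := hk
    have hmin' : ∀ i, H.Adj i ⟨h - 1, hlo⟩ → k ≤ i := fun i hi => not_lt.1 (hmin i hi)
    have hklt : k < ⟨h - 1, hlo⟩ :=
      lt_of_le_of_ne (Fin.le_def.2 (Nat.le_sub_one_of_lt k.2)) hk.ne
    have hk2 := (hmid _ _ hk hklt).1
    refine ⟨k, k.2, fun i j hij hlt => ⟨fun hj => ?_, fun hj => ⟨?_, ?_⟩⟩⟩
    · obtain rfl : j = ⟨h - 1, hlo⟩ := Fin.ext (by simp only; omega)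
      exact hmin' i hij
    · exact hlast k _ hk (by simp only; omega) hmin' i j hij hlt hj
    · have := (hmid i j hij hlt).2
      omega
  · refine ⟨h / 2, by omega, fun i j hij hlt => ⟨fun hj => ?_, fun hj => ?_⟩⟩
    · obtain rfl : j = ⟨h - 1, hlo⟩ := Fin.ext (by simp only; omega)
      exact absurd ⟨i, hij⟩ hex
    · have := hmid i j hij hlt
      omega

lemma hasIsolatedFirst_of_not_propertyCLast (hA : PropertyA H) (h1 : 1 ≤ h)
    (hfirst : ∀ i j, H.Adj i j → (i : ℕ) ≠ 0) (hC : ¬ PropertyCLast H) :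
    HasIsolatedFirst H := by
  refine .of_middle hA.middle hfirst h1 fun k l hkl hl hmin i j hij hlt hj => ?_
  have hs : sOG H = k + 1 := by
    refine le_antisymm (Nat.sInf_le ⟨k, l, hkl, rfl, hl⟩) (le_csInf ⟨_, k, l, hkl, rfl, hl⟩ ?_)
    rintro _ ⟨a, c, hac, rfl, hc⟩
    obtain rfl : c = l := Fin.ext (by omega)
    exact Nat.succ_le_succ (hmin a hac)
  by_contra hki
  rw [Fin.lt_def] at hki hlt
  exact hC ⟨by omega, i, j, hij, by omega, by omega, by omega, by omega⟩

lemma hasIsolatedFirst_comap_rev (hA : PropertyA H) (h1 : 1 ≤ h)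
    (hlast : ∀ i j, H.Adj i j → (i : ℕ) + 1 ≠ h) (hC : ¬ PropertyCFirst H) :
    HasIsolatedFirst (H.comap Fin.rev) := by
  refine .of_middle (fun i j hij hlt => ?_) (fun i j hij => ?_) h1
    fun k l hkl hl hmin i j hij hlt hj => ?_
  · have := hA.middle _ _ (SimpleGraph.comap_adj.1 hij).symm (Fin.rev_lt_rev.2 hlt)
    simp only [Fin.val_rev] at this
    omega
  · have := hlast _ _ (SimpleGraph.comap_adj.1 hij)
    rw [Fin.val_rev] at this
    omega
  · rw [SimpleGraph.comap_adj] at hkl hij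
    have hl0 : (l.rev : ℕ) + 1 = 1 := by rw [Fin.val_rev]; omega
    have hs : lOG H = k.rev + 1 := by
      rw [lOG, if_pos ⟨_, _, hkl.symm, hl0⟩]
      refine IsGreatest.csSup_eq ⟨⟨_, _, hkl.symm, hl0, rfl⟩, ?_⟩
      rintro _ ⟨a, c, hac, ha, rfl⟩
      obtain rfl : a = l.rev := Fin.ext (by omega)
      have := hmin c.rev (by simpa using hac.symm)
      rw [Fin.le_def, Fin.val_rev] at this
      rw [Fin.val_rev]
      omega
    by_contra hki
    rw [Fin.lt_def] at hki hlt
    refine hC ⟨by have := k.rev.2; omega, _, _, hij, ?_⟩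
    rw [hs]
    simp only [Fin.val_rev]
    omega

lemma IsCopySet.image_rev {T : Finset (Fin n)}
    (hT : IsCopySet (H.comap Fin.rev) (G.comap Fin.rev) T) : IsCopySet H G (T.image Fin.rev) := by
  obtain ⟨φ, ⟨hφ, hadj⟩, rfl⟩ := hT
  refine ⟨fun i => (φ i.rev).rev, ⟨fun i j hij => ?_, fun i j hij => ?_⟩, ?_⟩
  · exact Fin.rev_lt_rev.2 (hφ (Fin.rev_lt_rev.2 hij))
  · exact hadj i.rev j.rev (by simpa using hij)
  · ext x
    simp only [Finset.mem_image, Finset.mem_univ, true_and, exists_exists_eq_and]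
    exact ⟨fun ⟨i, hi⟩ => ⟨i.rev, hi⟩, fun ⟨i, hi⟩ => ⟨i.rev, by simpa using hi⟩⟩

lemma HasPerfectTilingOn.image_rev {S : Finset (Fin n)}
    (hS : HasPerfectTilingOn (H.comap Fin.rev) (G.comap Fin.rev) S) :
    HasPerfectTilingOn H G (S.image Fin.rev) := by
  obtain ⟨A, hA, hdisj, rfl⟩ := hS
  refine ⟨A.image fun T => T.image Fin.rev, ?_, ?_, ?_⟩
  · intro T hT
    obtain ⟨T', hT', rfl⟩ := Finset.mem_image.1 hT
    exact (hA T' hT').image_rev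
  · intro T hT T' hT' hne
    rw [Finset.coe_image] at hT hT'
    obtain ⟨X, hX, rfl⟩ := hT
    obtain ⟨X', hX', rfl⟩ := hT'
    exact (Finset.disjoint_image Fin.rev_injective).2
      (hdisj hX hX' fun hXX' => hne (congrArg (Finset.image Fin.rev) hXX'))
  · rw [Finset.image_biUnion, Finset.biUnion_image]
    rfl

lemma odeg_comap_rev (v : Fin n) : odeg (G.comap Fin.rev) v = odeg G v.rev := by
  rw [odeg, odeg, ← Set.ncard_image_of_injective _ Fin.rev_injective]
  congr 1
  ext x
  simp only [Set.mem_image, SimpleGraph.mem_neighborSet, SimpleGraph.comap_adj]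
  exact ⟨by rintro ⟨y, hy, rfl⟩; exact hy, fun hx => ⟨x.rev, by simpa using hx, by simp⟩⟩

lemma isolated_of_not_propertyB (hA : PropertyA H) (hB : ¬ PropertyB H) :
    2 ≤ h ∧ ((∀ i j, H.Adj i j → (i : ℕ) ≠ 0) ∨ ∀ i j, H.Adj i j → (i : ℕ) + 1 ≠ h) := by
  simp only [PropertyB, not_forall, not_exists, not_and] at hB
  obtain ⟨k, hk1, hkh, hk⟩ := hB
  refine ⟨by omega, ?_⟩
  by_contra! hc
  obtain ⟨⟨a, c, hac, ha⟩, d, e, hde, hd⟩ := hc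
  have n1 := Fin.val_ne_of_ne hac.ne
  have n2 := Fin.val_ne_of_ne hde.ne
  have m1 := hA.middle a c hac (Fin.lt_def.2 (by omega))
  have m2 := hA.middle e d hde.symm (Fin.lt_def.2 (by omega))
  have k1 := hk a c hac (by omega)
  have k2 := hk e d hde.symm
  omega

end Reversal

theorem strong_absorbing_theorem (h : ℕ) (H : SimpleGraph (Fin h))
    (hchi : intervalChi H = 2)
    (hA : PropertyA H) (hB : ¬ PropertyB H)
    (hC1 : ¬ PropertyCFirst H) (hCh : ¬ PropertyCLast H)
    (η : ℝ) (hη : 0 < η) :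
    ∃ (n₀ : ℕ) (ν : ℝ), 0 < ν ∧ ∀ n : ℕ, n₀ ≤ n → ∀ G : SimpleGraph (Fin n),
      (∀ v : Fin n, η * n ≤ (odeg G v : ℝ)) →
      ∃ Abs : Finset (Fin n), (Abs.card : ℝ) ≤ ν * n ∧
        ∀ W : Finset (Fin n), Disjoint W Abs → h ∣ W.card →
          (W.card : ℝ) ≤ ν ^ 3 * n → IsAbsorbingFor H G Abs W := by
  suffices hmain : ∃ (n₀ : ℕ) (ν : ℝ), 0 < ν ∧ ∀ n : ℕ, n₀ ≤ n → ∀ G : SimpleGraph (Fin n),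
      (∀ v : Fin n, η * n ≤ (odeg G v : ℝ)) →
      ∃ S : Finset (Fin n), (S.card : ℝ) ≤ ν * n ∧
        ∀ W : Finset (Fin n), Disjoint W S → h ∣ W.card →
          (W.card : ℝ) ≤ ν ^ 3 * n → HasPerfectTilingOn H G (S ∪ W) by
    obtain ⟨n₀, ν, hν, hmain⟩ := hmain
    refine ⟨n₀, ν, hν, fun n hn G hdeg => ?_⟩
    obtain ⟨S, hS, hSW⟩ := hmain n hn G hdeg
    refine ⟨S, hS, fun W hW hWh hWc => ⟨?_, hSW W hW hWh hWc⟩⟩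
    simpa using hSW ∅ (Finset.disjoint_empty_left S) (by simp) (by simp; positivity)
  obtain ⟨h2, hfirst | hlast⟩ := isolated_of_not_propertyB hA hB
  · exact (hasIsolatedFirst_of_not_propertyCLast hA (by omega) hfirst hCh).exists_absorbing h2 hη
  · obtain ⟨n₀, ν, hν, hmain⟩ :=
      (hasIsolatedFirst_comap_rev hA (by omega) hlast hC1).exists_absorbing h2 hη
    refine ⟨n₀, ν, hν, fun n hn G hdeg => ?_⟩
    obtain ⟨S, hS, hSW⟩ := hmain n hn (G.comap Fin.rev) fun v => by
      rw [odeg_comap_rev]; exact hdeg _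
    refine ⟨S.image Fin.rev, ?_, fun W hW hWh hWc => ?_⟩
    · rwa [Finset.card_image_of_injective _ Fin.rev_injective]
    · have hWW : (W.image Fin.rev).image Fin.rev = W := by
        rw [Finset.image_image, Fin.rev_involutive.comp_self, Finset.image_id]
      have hcard := Finset.card_image_of_injective W Fin.rev_injective
      have := (hSW (W.image Fin.rev)
        ((Finset.disjoint_image Fin.rev_injective).1 (by rwa [hWW])) (by rwa [hcard])
        (by rwa [hcard])).image_rev
      rwa [Finset.image_union, hWW] at this
end
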